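/- arXiv:1912.00453 — 4 statements merged into one kernel-verified Lean document; each statement's English description precedes it below -/
import Mathlib

section
/- In the generic staircase situation, the core determinant φ_1 divides Σ_{i=0}^{k} c_i · ((−1)^{n−1} det Ȳ · φ_{n+1})^i · φ_2^{k−i} in the polynomial ring R; that is, there exists a polynomial φ_1* ∈ R such that φ_1 · φ_1* = Σ_{i=0}^{k} c_i · ((−1)^{n−1} det Ȳ · φ_{n+1})^i · φ_2^{k−i}. -/
open Matrix Finset

noncomputable section

/-- The determinant of the minor of the `ℕ`-indexed (0-based) matrix `Φ` on the 1-based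
row/column range `[i, M]`; for `i = M + 1` this is the determinant of the empty matrix, `1`. -/
def sminor {α : Type*} [CommRing α] (Φ : ℕ → ℕ → α) (i M : ℕ) : α :=
  (Matrix.of fun r c : Fin (M + 1 - i) => Φ (i - 1 + (r : ℕ)) (i - 1 + (c : ℕ))).det

/-- Package an `ℕ`-indexed (0-based) family of entries as an `n × n` matrix. -/
def toSq {α : Type*} (n : ℕ) (f : ℕ → ℕ → α) : Matrix (Fin n) (Fin n) α :=
  Matrix.of fun i j => f (i : ℕ) (j : ℕ)

/-- The core `Φ` of a staircase pair `(X, Y)` of `n × n` matrices with parameters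
`a = k + b`; it is an `N × N` matrix, `N = (k-1)*n + b`, given here as a (0-based)
`ℕ`-indexed family of entries.  For `1 ≤ j ≤ k-1` (1-based), the block rows
`(j-1)(n-1)+1 .. j(n-1)` carry `Y_{[2,n]}` in columns `(j-1)n+1 .. jn` and (for `j ≥ 2`)
`X_{[2,n]}` in columns `(j-2)n+1 .. (j-1)n`; the last `a - 1` rows carry `X_{[2,a]}` in
columns `(k-2)n+1 .. (k-1)n` and `Y_{[2,a]}^{[1,b]}` in columns `(k-1)n+1 .. N`. -/
def stairCore {α : Type*} [Zero α] (n k : ℕ) (Xf Yf : ℕ → ℕ → α) : ℕ → ℕ → α := fun r c =>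
  if r < (k - 1) * (n - 1) then
    if r / (n - 1) * n ≤ c ∧ c < r / (n - 1) * n + n then
      Yf (r % (n - 1) + 1) (c - r / (n - 1) * n)
    else if 1 ≤ r / (n - 1) ∧ (r / (n - 1) - 1) * n ≤ c ∧ c < r / (n - 1) * n then
      Xf (r % (n - 1) + 1) (c - (r / (n - 1) - 1) * n)
    else 0
  else
    if (k - 2) * n ≤ c ∧ c < (k - 1) * n then
      Xf (r - (k - 1) * (n - 1) + 1) (c - (k - 2) * n)
    else if (k - 1) * n ≤ c then
      Yf (r - (k - 1) * (n - 1) + 1) (c - (k - 1) * n)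
    else 0

/-- `det Ȳ`: determinant of the submatrix of `Y` on rows and columns `2..n` (1-based). -/
def detYbar {α : Type*} [CommRing α] (n : ℕ) (Yf : ℕ → ℕ → α) : α :=
  (Matrix.of fun i j : Fin (n - 1) => Yf ((i : ℕ) + 1) ((j : ℕ) + 1)).det

/-- Determinant of the minor of `Y` on rows `{1, 3, 4, …, n}` and columns `{2, …, n}`
(1-based). -/
def detYgamma {α : Type*} [CommRing α] (n : ℕ) (Yf : ℕ → ℕ → α) : α :=
  (Matrix.of fun i j : Fin (n - 1) =>
    Yf (if (i : ℕ) = 0 then 0 else (i : ℕ) + 1) ((j : ℕ) + 1)).det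

/-- `det (λ Y + μ X)` as a polynomial in the two variables `λ = X 0`, `μ = X 1`. -/
def detLM {α : Type*} [CommRing α] (n : ℕ) (Xf Yf : ℕ → ℕ → α) :
    MvPolynomial (Fin 2) α :=
  Matrix.det
    (((MvPolynomial.X 0 : MvPolynomial (Fin 2) α) • (toSq n Yf).map (fun p => MvPolynomial.C p)
      + (MvPolynomial.X 1 : MvPolynomial (Fin 2) α) • (toSq n Xf).map (fun p => MvPolynomial.C p)
      : Matrix (Fin n) (Fin n) (MvPolynomial (Fin 2) α)))

/-- The block `Y2`: submatrix of `Y` on rows `k+1 .. k+b` and columns `1 .. b` (1-based). -/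
def blockY2 (n k b : ℕ) (h : k + b ≤ n) (Y : Matrix (Fin n) (Fin n) ℂ) :
    Matrix (Fin b) (Fin b) ℂ :=
  Matrix.of fun i j => Y ⟨k + (i : ℕ), by have := i.isLt; omega⟩ (Fin.castLE (by omega) j)

/-- The `k × k` matrix `U = W11 - Y1 Y2⁻¹ W21` attached to a staircase pair `(X, Y)`,
where `[[W11, W12], [W21, W22]]` is the `a × a` leading block of `X Y⁻¹` (`W11` of size
`k × k`) and `[Y1; Y2]` is the submatrix of `Y` on rows `1..a`, columns `1..b`. -/
def blockU (n k b : ℕ) (h : k + b ≤ n) (X Y : Matrix (Fin n) (Fin n) ℂ) :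
    Matrix (Fin k) (Fin k) ℂ :=
  (Matrix.of fun i j : Fin k =>
      (X * Y⁻¹) (Fin.castLE (by omega) i) (Fin.castLE (by omega) j))
    - (Matrix.of fun (i : Fin k) (j : Fin b) =>
          Y (Fin.castLE (by omega) i) (Fin.castLE (by omega) j))
      * (blockY2 n k b h Y)⁻¹
      * (Matrix.of fun (i : Fin b) (j : Fin k) =>
          (X * Y⁻¹) ⟨k + (i : ℕ), by have := i.isLt; omega⟩ (Fin.castLE (by omega) j))

/-- The standard basis vector `e_{m+1}` (so `basisVec k 0 = e_1`, `basisVec k 1 = e_2`). -/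
def basisVec (k m : ℕ) : Fin k → ℂ := fun i => if (i : ℕ) = m then 1 else 0

/-- The vector `v_γ = U (e_2 + γ e_1)`, with `γ` the ratio of the minor of `Y` on rows
`{1,3,…,n}`, columns `{2,…,n}` by `det Ȳ`. -/
def vGamma (n k b : ℕ) (h : k + b ≤ n) (X Y : ℕ → ℕ → ℂ) : Fin k → ℂ :=
  (blockU n k b h (toSq n X) (toSq n Y)).mulVec
    (basisVec k 1 + (detYgamma n Y / detYbar n Y) • basisVec k 0)

/-- The coefficient ring for the generic staircase pair: polynomials over `ℂ` in the
variables `x_{ij}` (tagged `true`) and `y_{ij}` (tagged `false`). -/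
abbrev Rgen : Type := MvPolynomial (Bool × ℕ × ℕ) ℂ

/-- The generic staircase matrix `X` (0-based): `x_{ij}` for `i < a`, `b ≤ j < n`, else `0`. -/
def genX (n a b : ℕ) : ℕ → ℕ → Rgen := fun i j =>
  if i < a ∧ b ≤ j ∧ j < n then MvPolynomial.X (true, i, j) else 0

/-- The generic staircase matrix `Y` (0-based): `y_{ij}` except in the zero block
(`i ≥ a`, `j < b`). -/
def genY (n a b : ℕ) : ℕ → ℕ → Rgen := fun i j =>
  if i < n ∧ j < n ∧ ¬(a ≤ i ∧ j < b) then MvPolynomial.X (false, i, j) else 0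

/-- The coefficient ring for the generic band pair: polynomials over `ℂ` in variables
`a_{ij}`. -/
abbrev Rband : Type := MvPolynomial (ℕ × ℕ) ℂ

/-- The generic band entries `a_{ij}` (1-based). -/
def genA : ℕ → ℕ → Rband := fun i j => MvPolynomial.X (i, j)

/-- The band matrix `X` (0-based indices) built from the entries `a_{ij}` (1-based):
`X_{i, n-k+i-1+s} = a_{s,i}` for `1 ≤ i ≤ k`, `1 ≤ s ≤ k+1-i` (1-based). -/
def bandX {α : Type*} [Zero α] (n k : ℕ) (a : ℕ → ℕ → α) : ℕ → ℕ → α := fun i j =>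
  if i < k ∧ n - k + i ≤ j ∧ j < n then a (j + k + 1 - n - i) (i + 1) else 0

/-- The band matrix `Y` (0-based indices) built from the entries `a_{ij}` (1-based):
`Y_{ij} = a_{k+1-i+j, i}` for `max(1, i-k) ≤ j ≤ i` (1-based), `0` otherwise. -/
def bandY {α : Type*} [Zero α] (n k : ℕ) (a : ℕ → ℕ → α) : ℕ → ℕ → α := fun i j =>
  if j ≤ i ∧ i ≤ j + k ∧ i < n then a (k + 1 + j - i) (i + 1) else 0

/-- Top-left `k × k` block of `X * Y⁻¹`. -/
def bandUblock (n k : ℕ) (h : k ≤ n) (Xm Ym : Matrix (Fin n) (Fin n) ℂ) :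
    Matrix (Fin k) (Fin k) ℂ :=
  Matrix.of fun i j => (Xm * Ym⁻¹) (Fin.castLE h i) (Fin.castLE h j)

/-- `K(A;u) = [u, Au, …, A^{k-1}u]`. -/
def Kmat (k : ℕ) (A : Matrix (Fin k) (Fin k) ℂ) (u : Fin k → ℂ) :
    Matrix (Fin k) (Fin k) ℂ :=
  Matrix.of fun i j => (A ^ (j : ℕ)).mulVec u i

/-- `K1(A;u,v) = [v, u, Au, …, A^{k-2}u]`. -/
def K1mat (k : ℕ) (A : Matrix (Fin k) (Fin k) ℂ) (u v : Fin k → ℂ) :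
    Matrix (Fin k) (Fin k) ℂ :=
  Matrix.of fun i j => if (j : ℕ) = 0 then v i else (A ^ ((j : ℕ) - 1)).mulVec u i

/-- `K2(A;u,v) = [Av, u, Au, …, A^{k-2}u]`. -/
def K2mat (k : ℕ) (A : Matrix (Fin k) (Fin k) ℂ) (u v : Fin k → ℂ) :
    Matrix (Fin k) (Fin k) ℂ :=
  Matrix.of fun i j => if (j : ℕ) = 0 then A.mulVec v i else (A ^ ((j : ℕ) - 1)).mulVec u i

/-- `w`: the last row of the classical adjoint of `K1(A;u,v)`. -/
def wRow (k : ℕ) (A : Matrix (Fin k) (Fin k) ℂ) (u v : Fin k → ℂ) : Fin k → ℂ :=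
  fun j => (K1mat k A u v).adjugate ⟨k - 1, by have := j.isLt; omega⟩ j

/-- `K*(A;u,v)`: the matrix with rows `w, wA, …, wA^{k-1}`. -/
def Kstar (k : ℕ) (A : Matrix (Fin k) (Fin k) ℂ) (u v : Fin k → ℂ) :
    Matrix (Fin k) (Fin k) ℂ :=
  Matrix.of fun i j => Matrix.vecMul (wRow k A u v) (A ^ (i : ℕ)) j

/-- Extend a `k × k` matrix by zero to an `ℕ`-indexed family of entries. -/
def extMat {α : Type*} [Zero α] (k : ℕ) (M : Matrix (Fin k) (Fin k) α) : ℕ → ℕ → α :=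
  fun i j => if h : i < k ∧ j < k then M ⟨i, h.1⟩ ⟨j, h.2⟩ else 0

/-- Determinant of a block lower triangular matrix with `ℕ`-indexed entries. -/
theorem det_toSq_add {α : Type*} [CommRing α] (p q : ℕ) (g : ℕ → ℕ → α)
    (h : ∀ i < p, ∀ j < q, g i (p + j) = 0) :
    (toSq (p + q) g).det
      = (toSq p g).det * (toSq q fun i j => g (p + i) (p + j)).det := by
  rw [← Matrix.det_submatrix_equiv_self finSumFinEquiv (toSq (p + q) g)]
  have : (toSq (p + q) g).submatrix finSumFinEquiv finSumFinEquiv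
      = Matrix.fromBlocks (toSq p g) 0 (Matrix.of fun (i : Fin q) (j : Fin p) => g (p + i) j)
          (toSq q fun i j => g (p + i) (p + j)) := by
    ext i j
    rcases i with i | i <;> rcases j with j | j <;> simp [toSq]
    exact h i i.2 j j.2
  rw [this, Matrix.det_fromBlocks_zero₁₂]

theorem sminor_eq_det_toSq {α : Type*} [CommRing α] (Φ : ℕ → ℕ → α) {i M s : ℕ}
    (h : M + 1 - i = s) :
    sminor Φ i M = (toSq s fun r c => Φ (i - 1 + r) (i - 1 + c)).det := by
  subst h
  rfl

theorem adjugate_toSq_zero_zero {α : Type*} [CommRing α] (M : ℕ) (g : ℕ → ℕ → α) :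
    (toSq (M + 1) g).adjugate 0 0 = (toSq M fun i j => g (1 + i) (1 + j)).det := by
  rw [Matrix.adjugate_fin_succ_eq_det_submatrix]
  simp only [Fin.val_zero, add_zero, pow_zero, one_mul]
  congr 1
  ext i j
  simp [toSq, add_comm]

theorem adjugate_eq_det_updateCol {ι α : Type*} [Fintype ι] [DecidableEq ι] [CommRing α]
    (A : Matrix ι ι α) (i j : ι) :
    A.adjugate i j = (A.updateCol i (Pi.single j 1)).det := by
  rw [← Matrix.cramer_apply, Matrix.cramer_eq_adjugate_mulVec]
  simp

/-- If the first `m` rows of a matrix vanish beyond the first `m + 1` columns, the lower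
cofactors of the first column factor through those of the trailing block. -/
theorem adjugate_toSq_zero_add {α : Type*} [CommRing α] (m s : ℕ) (g : ℕ → ℕ → α)
    (h : ∀ i < m, ∀ j < s, g i (m + 1 + j) = 0) (p : Fin (s + 1)) :
    (toSq (m + s + 1) g).adjugate 0 (Fin.natAdd m p)
      = (-1) ^ m * (toSq m fun i j => g i (j + 1)).det
          * (toSq (s + 1) fun i j => g (m + i) (m + j)).adjugate 0 p := by
  set g' : ℕ → ℕ → α := fun i j =>
    if j < m then g i (j + 1) else if j = m then (if i = m + p then 1 else 0) else g i j with hg'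
  have hsub : ((toSq (m + s + 1) g).updateCol 0 (Pi.single (Fin.natAdd m p) 1)).submatrix id
      (Fin.cycleRange (⟨m, by omega⟩ : Fin (m + s + 1))) = toSq (m + (s + 1)) g' := by
    ext i j
    rcases lt_trichotomy (j : ℕ) m with hj | hj | hj
    · have hc : ((Fin.cycleRange (⟨m, by omega⟩ : Fin (m + s + 1))) j : ℕ) = j + 1 :=
        Fin.coe_cycleRange_of_lt (by simpa [Fin.lt_def] using hj)
      have hne : (Fin.cycleRange (⟨m, by omega⟩ : Fin (m + s + 1))) j ≠ 0 := by
        intro h0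
        rw [h0] at hc
        simp at hc
      simp only [Matrix.submatrix_apply, id, Matrix.updateCol_ne hne]
      simp [toSq, hg', hj, hc]
    · have hc : (Fin.cycleRange (⟨m, by omega⟩ : Fin (m + s + 1))) j = 0 :=
        Fin.cycleRange_of_eq (by ext; simpa using hj)
      simp only [Matrix.submatrix_apply, id, hc, Matrix.updateCol_self]
      simp [toSq, hg', hj, Pi.single_apply, Fin.ext_iff]
    · have hc : (Fin.cycleRange (⟨m, by omega⟩ : Fin (m + s + 1))) j = j :=
        Fin.cycleRange_of_gt (by simpa [Fin.lt_def] using hj)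
      have hne : j ≠ 0 := by
        intro h0
        rw [h0] at hj
        simp at hj
      simp only [Matrix.submatrix_apply, id, hc, Matrix.updateCol_ne hne]
      simp [toSq, hg', hj.ne', hj.le.not_gt]
  have hperm := Matrix.det_permute' (Fin.cycleRange (⟨m, by omega⟩ : Fin (m + s + 1)))
    ((toSq (m + s + 1) g).updateCol 0 (Pi.single (Fin.natAdd m p) 1))
  rw [hsub, Fin.sign_cycleRange, det_toSq_add m (s + 1) g'] at hperm
  · have h1 : toSq m g' = toSq m fun i j => g i (j + 1) := by
      ext i j
      simp [toSq, hg']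
    have h2 : (toSq (s + 1) fun i j => g' (m + i) (m + j))
        = (toSq (s + 1) fun i j => g (m + i) (m + j)).updateCol 0 (Pi.single p 1) := by
      ext i j
      refine Fin.cases ?_ (fun j => ?_) j
      · rw [Matrix.updateCol_self, Pi.single_apply]
        simp only [toSq, Matrix.of_apply, hg', Fin.val_zero, add_zero, lt_irrefl, if_false,
          if_true, Nat.add_left_cancel_iff, Fin.ext_iff]
      · rw [Matrix.updateCol_ne (Fin.succ_ne_zero j)]
        simp only [toSq, Matrix.of_apply, hg', Fin.val_succ]
        rw [if_neg (by omega), if_neg (by omega)]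
    rw [h1, h2, ← adjugate_eq_det_updateCol] at hperm
    rw [adjugate_eq_det_updateCol, mul_assoc, hperm, ← mul_assoc]
    push_cast
    rw [← mul_pow]
    simp
  · intro i hi j hj
    rcases Nat.eq_zero_or_pos j with rfl | hj0
    · simp only [hg', add_zero, lt_irrefl, if_false, if_true]
      rw [if_neg (by omega)]
    · obtain ⟨j, rfl⟩ : ∃ j', j = j' + 1 := ⟨j - 1, by omega⟩
      simp only [hg']
      rw [if_neg (by omega), if_neg (by omega), ← h i hi j (by omega)]
      congr 1
      omega

/-- A row vector killed by all columns of `A` but one is proportional to the cofactors of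
that column. -/
theorem adjugate_mul_eq_mul_adjugate {ι α : Type*} [Fintype ι] [DecidableEq ι] [CommRing α]
    (A : Matrix ι ι α) (i : ι) (v : ι → α) (h : ∀ j ≠ i, (v ᵥ* A) j = 0) (p r : ι) :
    A.adjugate i r * v p = v r * A.adjugate i p := by
  set B := A.updateCol i (Pi.single r 1) with hB
  have hv : v ᵥ* B = Pi.single i (v r) := by
    ext j
    by_cases hj : j = i
    · subst hj
      simp [hB, Matrix.vecMul, dotProduct, Pi.single_apply]
    · rw [Pi.single_eq_of_ne hj, ← h j hj]
      simp [hB, Matrix.vecMul, dotProduct, Matrix.updateCol_ne hj]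
  have hadj : B.adjugate i p = A.adjugate i p := by
    rw [adjugate_eq_det_updateCol, adjugate_eq_det_updateCol, hB, Matrix.updateCol_idem]
  have hmul : (v ᵥ* B) ᵥ* B.adjugate = B.det • v := by
    rw [Matrix.vecMul_vecMul, Matrix.mul_adjugate, Matrix.vecMul_smul, Matrix.vecMul_one]
  have := congrFun hmul p
  rw [hv, Matrix.single_vecMul] at this
  simp only [Pi.smul_apply, smul_eq_mul, Matrix.row] at this
  rw [adjugate_eq_det_updateCol A i r, ← hB, ← this, hadj]

theorem sum_range_mul_add {α : Type*} [AddCommMonoid α] (m k : ℕ) (f : ℕ → α) :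
    ∑ r ∈ range (k * m), f r = ∑ j ∈ range k, ∑ i ∈ range m, f (j * m + i) := by
  induction k with
  | zero => simp
  | succ k ih => rw [add_mul, one_mul, Finset.sum_range_add, ih, Finset.sum_range_succ]

/-- The block description of the core. -/
theorem stairCore_block {α : Type*} [Zero α] (m K : ℕ) (X Y : ℕ → ℕ → α) {j i p l : ℕ}
    (hj : j ≤ K + 1) (hi : i < m) (hp : p ≤ K + 1) (hl : l < m + 1) :
    stairCore (m + 1) (K + 2) X Y (j * m + i) (p * (m + 1) + l)
      = if p = j then Y (i + 1) l else if p + 1 = j then X (i + 1) l else 0 := by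
  have hle : ∀ q, q * (m + 1) ≤ p * (m + 1) + l ↔ q ≤ p := fun q => by
    rw [← Nat.le_div_iff_mul_le (Nat.succ_pos m), Nat.mul_comm p, Nat.mul_add_div (Nat.succ_pos m),
      Nat.div_eq_of_lt hl, add_zero]
  have hlt : ∀ q, p * (m + 1) + l < q * (m + 1) ↔ p < q := fun q => by
    rw [← not_le, hle, not_le]
  have hdiv : (j * m + i) / m = j := by
    rw [Nat.mul_comm, Nat.mul_add_div (by omega), Nat.div_eq_of_lt hi, add_zero]
  have hmod : (j * m + i) % m = i := by
    rw [Nat.mul_comm, Nat.mul_add_mod, Nat.mod_eq_of_lt hi]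
  have hrow : j * m + i < (K + 1) * m ↔ j < K + 1 := by
    rw [← Nat.div_lt_iff_lt_mul (by omega), hdiv]
  have hsucc : j * (m + 1) + (m + 1) = (j + 1) * (m + 1) := by ring
  simp only [stairCore, Nat.add_sub_cancel, show K + 2 - 1 = K + 1 from rfl,
    show K + 2 - 2 = K from rfl, hdiv, hmod, hrow, hsucc, hle, hlt]
  rcases Nat.lt_or_ge j (K + 1) with hjK | hjK
  · rw [if_pos hjK]
    by_cases h1 : p = j
    · subst h1
      simp
    · rw [if_neg (by omega), if_neg h1]
      by_cases h2 : p + 1 = j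
      · subst h2
        simp
      · rw [if_neg (by omega), if_neg h2]
  · obtain rfl : j = K + 1 := by omega
    rw [if_neg (by omega)]
    by_cases h1 : p = K + 1
    · subst h1
      simp
    · rw [if_neg h1]
      by_cases h2 : p = K
      · subst h2
        simp
      · rw [if_neg (by omega), if_neg (by omega), if_neg (by omega)]

/-- The pencil `Y + t X` over the polynomial ring in `t`. -/
def pencil {α : Type*} [CommRing α] (n : ℕ) (X Y : ℕ → ℕ → α) :
    Matrix (Fin n) (Fin n) (Polynomial α) :=
  Matrix.of fun i j => Polynomial.C (Y i j) + Polynomial.X * Polynomial.C (X i j)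

theorem natDegree_pencil_le_one {α : Type*} [CommRing α] (n : ℕ) (X Y : ℕ → ℕ → α)
    (i j : Fin n) : (pencil n X Y i j).natDegree ≤ 1 := by
  refine (Polynomial.natDegree_add_le _ _).trans (max_le (by simp) ?_)
  exact (Polynomial.natDegree_mul_C_le _ _).trans Polynomial.natDegree_X_le

theorem natDegree_pencil_eq_zero {α : Type*} [CommRing α] (n : ℕ) (X Y : ℕ → ℕ → α)
    {i j : Fin n} (h : X i j = 0) : (pencil n X Y i j).natDegree = 0 := by
  simp [pencil, h]

theorem sum_ite_val_lt {n a : ℕ} (h : a ≤ n) :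
    ∑ i : Fin n, (if (i : ℕ) < a then (1 : ℤ) else 0) = a := by
  rw [Fin.sum_univ_eq_sum_range (fun i => if i < a then (1 : ℤ) else 0) n, Finset.sum_boole]
  congr 1
  rw [show (range n).filter (fun i => i < a) = range a by ext; simp; omega, card_range]

/-- Degree bound for the cofactors of a staircase pencil of type `(a, b)`. -/
theorem coeff_adjugate_pencil {α : Type*} [CommRing α] {n a b : ℕ} (hba : b < a) (ha : a ≤ n)
    (X Y : ℕ → ℕ → α) (hX : ∀ i j, a ≤ i ∨ j < b → X i j = 0)
    (hY : ∀ i j, a ≤ i → j < b → Y i j = 0) (l r : Fin n) (hl : b ≤ l) (hr : (r : ℕ) < a) :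
    ((pencil n X Y).adjugate l r).coeff (a - b) = 0 := by
  rw [Matrix.adjugate_apply, Matrix.det_apply, Polynomial.finsetSum_coeff]
  refine Finset.sum_eq_zero fun σ _ => ?_
  set B := (pencil n X Y).updateRow r (Pi.single l 1) with hB
  suffices h : (∏ i, B (σ i) i).coeff (a - b) = 0 by
    rw [Polynomial.coeff_smul, h, smul_zero]
  by_cases hbad : ∃ i, B (σ i) i = 0
  · obtain ⟨i, hi⟩ := hbad
    have h0 : ∏ i, B (σ i) i = 0 := Finset.prod_eq_zero (Finset.mem_univ i) hi
    exact h0 ▸ Polynomial.coeff_zero _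
  push Not at hbad
  have hne : ∀ i, i ≠ l → σ i ≠ r := by
    intro i hi hir
    apply hbad i
    rw [hB, hir, Matrix.updateRow_self, Pi.single_eq_of_ne hi]
  have hσl : σ l = r := by
    by_contra hne'
    have := hne (σ.symm r) (fun h => hne' (by rw [← h, Equiv.apply_symm_apply]))
    exact this (Equiv.apply_symm_apply σ r)
  have hterm : ∀ i, ((B (σ i) i).natDegree : ℤ)
      ≤ (if (σ i : ℕ) < a then 1 else 0) - (if (i : ℕ) < b then 1 else 0)
          - (if i = l then 1 else 0) := by
    intro i
    by_cases hil : i = l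
    · subst hil
      rw [hB, hσl, Matrix.updateRow_self, Pi.single_eq_same]
      simp [hr, hl.not_gt]
    · have hBi : B (σ i) i = pencil n X Y (σ i) i := by
        rw [hB, Matrix.updateRow_ne (hne i hil)]
      have hnz : ¬ (a ≤ (σ i : ℕ) ∧ (i : ℕ) < b) := by
        rintro ⟨h1, h2⟩
        apply hbad i
        rw [hBi]
        simp [pencil, hX _ _ (Or.inl h1), hY _ _ h1 h2]
      have hX' : a ≤ (σ i : ℕ) ∨ (i : ℕ) < b → (B (σ i) i).natDegree = 0 := fun h => by
        rw [hBi, natDegree_pencil_eq_zero n X Y (hX _ _ h)]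
      have hle : (B (σ i) i).natDegree ≤ 1 := hBi ▸ natDegree_pencil_le_one n X Y (σ i) i
      split_ifs <;> omega
  have hsum : ∑ i, ((B (σ i) i).natDegree : ℤ) ≤ a - b - 1 := by
    refine (Finset.sum_le_sum fun i _ => hterm i).trans (le_of_eq ?_)
    rw [Finset.sum_sub_distrib, Finset.sum_sub_distrib, sum_ite_val_lt (by omega : b ≤ n),
      Equiv.sum_comp σ (fun i : Fin n => if (i : ℕ) < a then (1 : ℤ) else 0), sum_ite_val_lt ha]
    simp
  apply Polynomial.coeff_eq_zero_of_natDegree_lt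
  have := Polynomial.natDegree_prod_le Finset.univ fun i => B (σ i) i
  push_cast [← Nat.cast_sum] at hsum
  zify [hba.le]
  have h2 : ((∏ i, B (σ i) i).natDegree : ℤ) ≤ ∑ i, ((B (σ i) i).natDegree : ℤ) := by
    exact_mod_cast this
  omega

/-- Coefficient extraction in `(Y + t X) * adj (Y + t X) = det (Y + t X)`. -/
theorem coeff_pencil_mul_adjugate {α : Type*} [CommRing α] (n : ℕ) (X Y : ℕ → ℕ → α)
    (i r : Fin n) (d : ℕ) :
    (toSq n Y *ᵥ fun l => ((pencil n X Y).adjugate l r).coeff d) i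
      + (if d = 0 then 0
          else (toSq n X *ᵥ fun l => ((pencil n X Y).adjugate l r).coeff (d - 1)) i)
      = if i = r then (pencil n X Y).det.coeff d else 0 := by
  have h := congrArg (fun p => Polynomial.coeff p d)
    (congrFun (congrFun (Matrix.mul_adjugate (pencil n X Y)) i) r)
  have hR : ((pencil n X Y).det • (1 : Matrix (Fin n) (Fin n) (Polynomial α))) i r
      = if i = r then (pencil n X Y).det else 0 := by
    simp [Matrix.one_apply]
  simp only [hR] at h
  rw [show (if i = r then (pencil n X Y).det.coeff d else 0)
    = (if i = r then (pencil n X Y).det else 0).coeff d by split_ifs <;> simp, ← h]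
  simp only [Matrix.mul_apply, Polynomial.finsetSum_coeff, Matrix.mulVec, dotProduct]
  rcases d with _ | d
  · simp [pencil, toSq, add_mul, mul_assoc]
  · simp [pencil, toSq, add_mul, mul_assoc, Finset.sum_add_distrib, Polynomial.coeff_X_mul]

/-- A sequence of row vectors satisfying the recursion attached to the pencil `Y + t X`
annihilates the coefficients of its determinant. -/
theorem sum_coeff_det_pencil_mul {α : Type*} [CommRing α] {n k : ℕ} (X Y : ℕ → ℕ → α)
    (r : Fin n) (V : ℕ → Fin n → α)
    (hV : ∀ i < k, V i ᵥ* toSq n Y + V (i + 1) ᵥ* toSq n X = 0)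
    (hk : ∀ l, (V k ᵥ* toSq n Y) l * ((pencil n X Y).adjugate l r).coeff k = 0) :
    ∑ i ∈ range (k + 1), (pencil n X Y).det.coeff i * V i r = 0 := by
  set q : ℕ → Fin n → α := fun d l => ((pencil n X Y).adjugate l r).coeff d with hq
  have h1 : ∀ d, (pencil n X Y).det.coeff d * V d r
      = V d ⬝ᵥ (toSq n Y *ᵥ q d) + if d = 0 then 0 else V d ⬝ᵥ (toSq n X *ᵥ q (d - 1)) := by
    intro d
    have : V d ⬝ᵥ (toSq n Y *ᵥ q d) + (if d = 0 then 0 else V d ⬝ᵥ (toSq n X *ᵥ q (d - 1)))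
        = V d ⬝ᵥ fun i => if i = r then (pencil n X Y).det.coeff d else 0 := by
      simp only [← coeff_pencil_mul_adjugate]
      split_ifs with h
      · simp [dotProduct, hq]
      · rw [← dotProduct_add]
        rfl
    rw [this]
    simp [dotProduct, mul_comm]
  simp only [h1]
  rw [Finset.sum_add_distrib, Finset.sum_range_succ,
    Finset.sum_range_succ' (fun d => if d = 0 then 0 else V d ⬝ᵥ (toSq n X *ᵥ q (d - 1)))]
  have hlast : V k ⬝ᵥ (toSq n Y *ᵥ q k) = 0 := by
    rw [Matrix.dotProduct_mulVec]
    exact Finset.sum_eq_zero fun l _ => hk l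
  simp only [hlast, add_zero, if_true, Nat.succ_ne_zero, if_false, Nat.add_sub_cancel]
  rw [← Finset.sum_add_distrib]
  refine Finset.sum_eq_zero fun d hd => ?_
  rw [Matrix.dotProduct_mulVec, Matrix.dotProduct_mulVec, ← add_dotProduct,
    hV d (Finset.mem_range.1 hd), zero_dotProduct]

theorem stairCore_shift {α : Type*} [Zero α] {m K b : ℕ} (hn : K + 2 + b ≤ m + 1)
    (X Y : ℕ → ℕ → α) {p q : ℕ} (hp : p ≤ K * (m + 1) + b) (hq : q < K * (m + 1) + b) :
    stairCore (m + 1) (K + 2) X Y (m + p) (m + 1 + q)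
      = stairCore (m + 1) (K + 2) X Y p q := by
  have hm : 0 < m := by omega
  have hpK : p / m ≤ K := by
    rw [← Nat.lt_succ_iff, Nat.div_lt_iff_lt_mul hm]
    nlinarith
  have hqK : q / (m + 1) ≤ K := by
    rw [← Nat.lt_succ_iff, Nat.div_lt_iff_lt_mul (Nat.succ_pos m)]
    nlinarith
  have hp' : p = p / m * m + p % m := (Nat.div_add_mod' p m).symm
  have hq' : q = q / (m + 1) * (m + 1) + q % (m + 1) := (Nat.div_add_mod' q (m + 1)).symm
  have e1 : m + p = (p / m + 1) * m + p % m := by rw [add_mul]; omega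
  have e2 : m + 1 + q = (q / (m + 1) + 1) * (m + 1) + q % (m + 1) := by
    rw [add_mul _ _ (m + 1)]; omega
  have h1 := stairCore_block m K X Y (by omega : p / m + 1 ≤ K + 1) (Nat.mod_lt p hm)
    (by omega : q / (m + 1) + 1 ≤ K + 1) (Nat.mod_lt q (Nat.succ_pos m))
  have h2 := stairCore_block m K X Y (by omega : p / m ≤ K + 1) (Nat.mod_lt p hm)
    (by omega : q / (m + 1) ≤ K + 1) (Nat.mod_lt q (Nat.succ_pos m))
  rw [← e1, ← e2] at h1
  rw [← hp', ← hq'] at h2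
  rw [h1, h2]
  simp only [Nat.add_right_cancel_iff]

theorem stairCore_bottom_left {α : Type*} [Zero α] {m K b : ℕ} (hn : K + 2 + b ≤ m + 1)
    (X Y : ℕ → ℕ → α) (hX : ∀ i j, K + 2 + b ≤ i ∨ j < b → X i j = 0)
    (hY : ∀ i j, K + 2 + b ≤ i → j < b → Y i j = 0) {r q : ℕ}
    (hr : K * (m + 1) + b < r) (hr' : r < (K + 2) * m) (hq : q < K * (m + 1) + b) :
    stairCore (m + 1) (K + 2) X Y r q = 0 := by
  have hm : 0 < m := by omega
  have hrK : r / m ≤ K + 1 := by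
    rw [← Nat.lt_succ_iff, Nat.div_lt_iff_lt_mul hm]
    exact hr'
  have hqK : q / (m + 1) ≤ K := by
    rw [← Nat.lt_succ_iff, Nat.div_lt_iff_lt_mul (Nat.succ_pos m)]
    nlinarith
  have hKr : K ≤ r / m := by
    rw [Nat.le_div_iff_mul_le hm]
    nlinarith
  have e1 : r / m * m + r % m = r := Nat.div_add_mod' r m
  have e2 : q / (m + 1) * (m + 1) + q % (m + 1) = q := Nat.div_add_mod' q (m + 1)
  have h := stairCore_block m K X Y hrK (Nat.mod_lt r hm)
    (by omega : q / (m + 1) ≤ K + 1) (Nat.mod_lt q (Nat.succ_pos m))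
  rw [e1, e2] at h
  rw [h]
  have hrow : r / m = K → K + 2 + b ≤ r % m + 1 := by
    intro hK
    rw [hK] at e1
    nlinarith
  have hcol : q / (m + 1) = K → q % (m + 1) < b := by
    intro hK
    rw [hK] at e2
    omega
  split_ifs with h1 h2
  · exact hY _ _ (hrow (by omega)) (hcol (by omega))
  · rcases hKr.lt_or_eq with h3 | h3
    · exact hX _ _ (Or.inr (hcol (by omega)))
    · exact hX _ _ (Or.inl (hrow h3.symm))
  · rfl

theorem stairCore_top_right {α : Type*} [Zero α] {m K b : ℕ} (hn : K + 2 + b ≤ m + 1)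
    (X Y : ℕ → ℕ → α) {i q : ℕ} (hi : i < m) (hq : q < K * (m + 1) + b) :
    stairCore (m + 1) (K + 2) X Y i (m + 1 + q) = 0 := by
  have hqK : q / (m + 1) ≤ K := by
    rw [← Nat.lt_succ_iff, Nat.div_lt_iff_lt_mul (Nat.succ_pos m)]
    nlinarith
  have e2 : m + 1 + q = (q / (m + 1) + 1) * (m + 1) + q % (m + 1) := by
    have := Nat.div_add_mod' q (m + 1)
    rw [add_mul _ _ (m + 1)]; omega
  have h := stairCore_block m K X Y (Nat.zero_le (K + 1)) hi
    (by omega : q / (m + 1) + 1 ≤ K + 1) (Nat.mod_lt q (Nat.succ_pos m))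
  rw [← e2, zero_mul, zero_add] at h
  rw [h, if_neg (Nat.succ_ne_zero _), if_neg (Nat.succ_ne_zero _)]

/-- The first row of the adjugate of the core, as an `ℕ`-indexed family. -/
def coreKer {α : Type*} [CommRing α] (m K b : ℕ) (X Y : ℕ → ℕ → α) (r : ℕ) : α :=
  if h : r < m + (K * (m + 1) + b) + 1 then
    (toSq (m + (K * (m + 1) + b) + 1) (stairCore (m + 1) (K + 2) X Y)).adjugate 0 ⟨r, h⟩
  else 0

theorem sum_coreKer_mul_stairCore {α : Type*} [CommRing α] (m K b : ℕ) (X Y : ℕ → ℕ → α)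
    (hdet : (toSq (m + (K * (m + 1) + b) + 1) (stairCore (m + 1) (K + 2) X Y)).det = 0)
    {M c : ℕ} (hM : m + (K * (m + 1) + b) + 1 ≤ M) (hc : c < m + (K * (m + 1) + b) + 1) :
    ∑ r ∈ range M, coreKer m K b X Y r * stairCore (m + 1) (K + 2) X Y r c = 0 := by
  have h := congrFun (congrFun (Matrix.adjugate_mul
    (toSq (m + (K * (m + 1) + b) + 1) (stairCore (m + 1) (K + 2) X Y))) 0) ⟨c, hc⟩
  rw [hdet, zero_smul, Matrix.mul_apply] at h
  rw [← Finset.sum_subset (Finset.range_subset_range.2 hM), ← Fin.sum_univ_eq_sum_range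
    (fun r => coreKer m K b X Y r * stairCore (m + 1) (K + 2) X Y r c)]
  · refine Eq.trans (Finset.sum_congr rfl fun r _ => ?_) h
    rw [coreKer, dif_pos r.2]
    rfl
  · intro r _ hr
    rw [Finset.mem_range, not_lt] at hr
    rw [coreKer, dif_neg (by omega), zero_mul]

/-- The kernel row of a degenerate core is a geometric progression in the block index. -/
theorem coreKer_proportional {α : Type*} [CommRing α] {m K b : ℕ} (hn : K + 2 + b ≤ m + 1)
    (X Y : ℕ → ℕ → α) (hX : ∀ i j, K + 2 + b ≤ i ∨ j < b → X i j = 0)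
    (hY : ∀ i j, K + 2 + b ≤ i → j < b → Y i j = 0)
    (hdet : (toSq (m + (K * (m + 1) + b) + 1) (stairCore (m + 1) (K + 2) X Y)).det = 0)
    {p : ℕ} (hp : p ≤ K * (m + 1) + b) :
    coreKer m K b X Y 0 * coreKer m K b X Y (m + p)
      = coreKer m K b X Y m * coreKer m K b X Y p := by
  set s := K * (m + 1) + b with hs
  have hM : m + s + 1 ≤ (K + 2) * m := by rw [hs]; nlinarith
  have hfac : ∀ p : Fin (s + 1), coreKer m K b X Y (m + p)
      = (-1) ^ m * (toSq m fun i j => stairCore (m + 1) (K + 2) X Y i (j + 1)).det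
        * (toSq (s + 1) fun i j =>
            stairCore (m + 1) (K + 2) X Y (m + i) (m + j)).adjugate 0 p := by
    intro p
    rw [coreKer, dif_pos (by omega), ← adjugate_toSq_zero_add]
    · rfl
    · exact fun i hi j hj => stairCore_top_right hn X Y hi hj
  have hker : ∀ q ≠ (0 : Fin (s + 1)), ((fun r : Fin (s + 1) => coreKer m K b X Y r) ᵥ*
      (toSq (s + 1) fun i j => stairCore (m + 1) (K + 2) X Y (m + i) (m + j))) q = 0 := by
    intro q hq
    obtain ⟨q, rfl⟩ := Fin.exists_succ_eq.2 hq
    rw [← sum_coreKer_mul_stairCore m K b X Y hdet hM (by omega : (q : ℕ) < m + s + 1),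
      ← Finset.sum_subset (Finset.range_subset_range.2 (by omega : s + 1 ≤ (K + 2) * m))]
    · rw [← Fin.sum_univ_eq_sum_range
        (fun r => coreKer m K b X Y r * stairCore (m + 1) (K + 2) X Y r q)]
      simp only [Matrix.vecMul, dotProduct]
      refine Finset.sum_congr rfl fun r _ => ?_
      rw [← stairCore_shift hn X Y (by omega : (r : ℕ) ≤ K * (m + 1) + b) q.2]
      simp only [toSq, Matrix.of_apply, Fin.val_succ]
      rw [show m + ((q : ℕ) + 1) = m + 1 + q by omega]
    · intro r hr hr'
      rw [Finset.mem_range] at hr hr'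
      rw [stairCore_bottom_left hn X Y hX hY (by omega) hr q.2, mul_zero]
  have hprop := adjugate_mul_eq_mul_adjugate _ (0 : Fin (s + 1)) _ hker
    ⟨p, Nat.lt_succ_of_le hp⟩ 0
  have h0 := hfac 0
  have hp' := hfac ⟨p, Nat.lt_succ_of_le hp⟩
  simp only [Fin.val_zero, add_zero] at h0 hprop hp'
  rw [h0, hp', mul_assoc _ _ (coreKer m K b X Y p), hprop]
  ring

/-- The `j`-th block of the kernel row, preceded by a zero entry. -/
def coreKerBlock {α : Type*} [CommRing α] (m K b : ℕ) (X Y : ℕ → ℕ → α) (j : ℕ) :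
    Fin (m + 1) → α :=
  Fin.cons 0 fun i : Fin m => coreKer m K b X Y (j * m + i)

theorem coreKerBlock_vecMul {α : Type*} [CommRing α] (m K b : ℕ) (X Y Z : ℕ → ℕ → α) (j : ℕ)
    (l : Fin (m + 1)) : (coreKerBlock m K b X Y j ᵥ* toSq (m + 1) Z) l
      = ∑ i ∈ range m, coreKer m K b X Y (j * m + i) * Z (i + 1) l := by
  rw [← Fin.sum_univ_eq_sum_range (fun i => coreKer m K b X Y (j * m + i) * Z (i + 1) l)]
  simp [Matrix.vecMul, dotProduct, Fin.sum_univ_succ, coreKerBlock, toSq]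

theorem coreKerBlock_relation {α : Type*} [CommRing α] {m K b : ℕ} (hn : K + 2 + b ≤ m + 1)
    (X Y : ℕ → ℕ → α)
    (hdet : (toSq (m + (K * (m + 1) + b) + 1) (stairCore (m + 1) (K + 2) X Y)).det = 0)
    {p : ℕ} (hp : p ≤ K + 1) (l : Fin (m + 1)) (hl : p = K + 1 → (l : ℕ) < b) :
    (coreKerBlock m K b X Y p ᵥ* toSq (m + 1) Y) l
      + (if p ≤ K then (coreKerBlock m K b X Y (p + 1) ᵥ* toSq (m + 1) X) l else 0) = 0 := by
  have hM : m + (K * (m + 1) + b) + 1 ≤ (K + 2) * m := by nlinarith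
  have hc : p * (m + 1) + l < m + (K * (m + 1) + b) + 1 := by
    rcases hp.lt_or_eq with h | h
    · have := Nat.mul_le_mul_right (m + 1) (Nat.lt_succ_iff.1 h)
      omega
    · have := hl h
      subst h
      nlinarith
  have hsum := sum_coreKer_mul_stairCore m K b X Y hdet hM hc
  rw [sum_range_mul_add] at hsum
  have hinner : ∀ j ∈ range (K + 2), ∑ i ∈ range m, coreKer m K b X Y (j * m + i)
      * stairCore (m + 1) (K + 2) X Y (j * m + i) (p * (m + 1) + l)
      = (if p = j then (coreKerBlock m K b X Y j ᵥ* toSq (m + 1) Y) l else 0)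
        + if p + 1 = j then (coreKerBlock m K b X Y j ᵥ* toSq (m + 1) X) l else 0 := by
    intro j hj
    rw [Finset.mem_range] at hj
    rw [coreKerBlock_vecMul, coreKerBlock_vecMul]
    have : ∀ i ∈ range m, coreKer m K b X Y (j * m + i)
        * stairCore (m + 1) (K + 2) X Y (j * m + i) (p * (m + 1) + l)
        = coreKer m K b X Y (j * m + i)
          * if p = j then Y (i + 1) l else if p + 1 = j then X (i + 1) l else 0 := by
      intro i hi
      rw [stairCore_block m K X Y (by omega) (Finset.mem_range.1 hi) hp l.2]
    rw [Finset.sum_congr rfl this]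
    split_ifs with h1 h2 <;> first | omega | simp
  rw [Finset.sum_congr rfl hinner, Finset.sum_add_distrib, Finset.sum_ite_eq,
    Finset.sum_ite_eq] at hsum
  simpa only [Finset.mem_range, show p < K + 2 by omega, if_true,
    show (p + 1 < K + 2) ↔ p ≤ K by omega] using hsum

theorem coreKerBlock_proportional {α : Type*} [CommRing α] {m K b : ℕ} (hn : K + 2 + b ≤ m + 1)
    (X Y : ℕ → ℕ → α) (hX : ∀ i j, K + 2 + b ≤ i ∨ j < b → X i j = 0)
    (hY : ∀ i j, K + 2 + b ≤ i → j < b → Y i j = 0)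
    (hdet : (toSq (m + (K * (m + 1) + b) + 1) (stairCore (m + 1) (K + 2) X Y)).det = 0)
    {j : ℕ} (hj : j ≤ K) (r : Fin (m + 1)) (hr : (r : ℕ) < K + 2 + b) :
    coreKer m K b X Y 0 * coreKerBlock m K b X Y (j + 1) r
      = coreKer m K b X Y m * coreKerBlock m K b X Y j r := by
  refine Fin.cases ?_ (fun i hi => ?_) r hr
  · simp [coreKerBlock]
  · rw [Fin.val_succ] at hi
    have hjm : j * m ≤ K * m := Nat.mul_le_mul_right m hj
    have hp : j * m + i ≤ K * (m + 1) + b := by rw [mul_add]; omega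
    have h := coreKer_proportional hn X Y hX hY hdet hp
    simp only [coreKerBlock, Fin.cons_succ]
    rw [show (j + 1) * m + (i : ℕ) = m + (j * m + i) by ring, h]

/-- The homogenized determinant of the pencil vanishes at the ratio of consecutive blocks of
the kernel row whenever the core is degenerate. -/
theorem sum_coeff_det_pencil_eq_zero {α : Type*} [CommRing α] {m K b : ℕ}
    (hn : K + 2 + b ≤ m + 1)
    (X Y : ℕ → ℕ → α) (hX : ∀ i j, K + 2 + b ≤ i ∨ j < b → X i j = 0)
    (hY : ∀ i j, K + 2 + b ≤ i → j < b → Y i j = 0)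
    (hdet : (toSq (m + (K * (m + 1) + b) + 1) (stairCore (m + 1) (K + 2) X Y)).det = 0) :
    ∑ i ∈ range (K + 3), (pencil (m + 1) X Y).det.coeff i * coreKer m K b X Y m ^ i
      * coreKer m K b X Y 0 ^ (K + 2 - i) = 0 := by
  set x := coreKer m K b X Y 0 with hx
  set y := coreKer m K b X Y m with hy
  set W := coreKerBlock m K b X Y with hW
  set r : Fin (m + 1) := ⟨1, by omega⟩ with hr
  have hrel : ∀ p ≤ K, W p ᵥ* toSq (m + 1) Y + W (p + 1) ᵥ* toSq (m + 1) X = 0 := by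
    intro p hp
    ext l
    have h := coreKerBlock_relation hn X Y hdet (by omega : p ≤ K + 1) l (by omega)
    rwa [if_pos hp] at h
  have hprop : ∀ j ≤ K, ∀ i : Fin (m + 1), (i : ℕ) < K + 2 + b →
      x * W (j + 1) i = y * W j i := fun j hj i hi =>
    coreKerBlock_proportional hn X Y hX hY hdet hj i hi
  have hpropX : (y • W K) ᵥ* toSq (m + 1) X = (x • W (K + 1)) ᵥ* toSq (m + 1) X := by
    ext l
    simp only [Matrix.vecMul, dotProduct]
    refine Finset.sum_congr rfl fun i _ => ?_
    rcases lt_or_ge (i : ℕ) (K + 2 + b) with hi | hi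
    · simp only [Pi.smul_apply, smul_eq_mul, hprop K le_rfl i hi]
    · simp [toSq, hX _ _ (Or.inl hi)]
  set V : ℕ → Fin (m + 1) → α := fun i =>
    if i ≤ K then x • W i else if i = K + 1 then y • W K else y • W (K + 1) with hV
  have hVle : ∀ i ≤ K, V i = x • W i := fun i hi => by simp [hV, hi]
  have hV1 : V (K + 1) = y • W K := by simp [hV]
  have hV2 : V (K + 2) = y • W (K + 1) := by simp [hV]
  have hsum := sum_coeff_det_pencil_mul (k := K + 2) X Y r V (fun i hi => ?_) (fun l => ?_)
  · have hW0 : W 0 r = x := by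
      obtain ⟨m, rfl⟩ : ∃ m', m = m' + 1 := ⟨m - 1, by omega⟩
      have : r = Fin.succ 0 := rfl
      rw [this, hW, coreKerBlock, Fin.cons_succ]
      simp [hx]
    have hW1 : W 1 r = y := by
      obtain ⟨m, rfl⟩ : ∃ m', m = m' + 1 := ⟨m - 1, by omega⟩
      have : r = Fin.succ 0 := rfl
      rw [this, hW, coreKerBlock, Fin.cons_succ]
      simp [hy]
    have hstep : ∀ j ≤ K, x * W (j + 1) r = y * W j r := fun j hj =>
      hprop j hj r (by simp [hr]; omega)
    have hpow : ∀ i ≤ K + 1, x ^ i * W i r = y ^ i * x := by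
      intro i hi
      induction i with
      | zero => simp [hW0]
      | succ i ih =>
        rw [pow_succ, mul_assoc, hstep i (by omega), pow_succ, mul_left_comm, ih (by omega)]
        ring
    have hpow' : ∀ i ≤ K, x ^ i * W (i + 1) r = y ^ i * y := by
      intro i hi
      induction i with
      | zero => simp [hW1]
      | succ i ih =>
        rw [pow_succ, mul_assoc, hstep (i + 1) (by omega), pow_succ, mul_left_comm,
          ih (by omega)]
        ring
    rw [← mul_zero (x ^ K), ← hsum, Finset.mul_sum]
    refine Finset.sum_congr rfl fun i hi => ?_
    have hi' : i < K + 3 := Finset.mem_range.1 hi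
    suffices h : x ^ K * V i r = y ^ i * x ^ (K + 2 - i) by
      rw [mul_left_comm, h, mul_assoc]
    rcases (by omega : i ≤ K ∨ i = K + 1 ∨ i = K + 2) with h | rfl | rfl
    · obtain ⟨d, rfl⟩ := Nat.exists_eq_add_of_le h
      rw [hVle _ h, Pi.smul_apply, smul_eq_mul, show i + d + 2 - i = d + 2 by omega]
      linear_combination x ^ (d + 1) * hpow i (by omega)
    · rw [hV1, Pi.smul_apply, smul_eq_mul, show K + 2 - (K + 1) = 1 by omega]
      linear_combination y * hpow K (by omega)
    · rw [hV2, Pi.smul_apply, smul_eq_mul, Nat.sub_self]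
      linear_combination y * hpow' K le_rfl
  · rcases (by omega : i < K ∨ i = K ∨ i = K + 1) with h | rfl | rfl
    · rw [hVle i h.le, hVle (i + 1) h, Matrix.smul_vecMul, Matrix.smul_vecMul, ← smul_add,
        hrel i h.le, smul_zero]
    · rw [hVle i le_rfl, hV1, hpropX, Matrix.smul_vecMul, Matrix.smul_vecMul, ← smul_add,
        hrel i le_rfl, smul_zero]
    · rw [hV1, hV2, Matrix.smul_vecMul, Matrix.smul_vecMul, ← smul_add, hrel K le_rfl, smul_zero]
  · rcases lt_or_ge (l : ℕ) b with hl | hl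
    · have h := coreKerBlock_relation hn X Y hdet le_rfl l (fun _ => hl)
      rw [if_neg (by omega), add_zero] at h
      rw [hV2, Matrix.smul_vecMul, Pi.smul_apply, h, smul_zero, zero_mul]
    · have h := coeff_adjugate_pencil (by omega : b < K + 2 + b) hn X Y hX hY l r hl
        (by simp [hr]; omega)
      rw [Nat.add_sub_cancel] at h
      rw [h, mul_zero]

theorem coreKer_zero {α : Type*} [CommRing α] (m K b : ℕ) (X Y : ℕ → ℕ → α) :
    coreKer m K b X Y 0
      = sminor (stairCore (m + 1) (K + 2) X Y) 2 ((K + 1) * (m + 1) + b) := by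
  have h : (K + 1) * (m + 1) + b + 1 - 2 = m + (K * (m + 1) + b) := by
    rw [add_mul K 1]; omega
  rw [sminor_eq_det_toSq _ h, coreKer, dif_pos (by omega)]
  exact adjugate_toSq_zero_zero _ _

theorem coreKer_block_start {α : Type*} [CommRing α] {m K b : ℕ} (hn : K + 2 + b ≤ m + 1)
    (X Y : ℕ → ℕ → α) :
    coreKer m K b X Y m = (-1) ^ m * detYbar (m + 1) Y
      * sminor (stairCore (m + 1) (K + 2) X Y) (m + 1 + 1) ((K + 1) * (m + 1) + b) := by
  have h : (K + 1) * (m + 1) + b + 1 - (m + 1 + 1) = K * (m + 1) + b := by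
    rw [add_mul K 1]; omega
  rw [sminor_eq_det_toSq _ h, coreKer, dif_pos (by omega)]
  have hfac := adjugate_toSq_zero_add m (K * (m + 1) + b) (stairCore (m + 1) (K + 2) X Y)
    (fun i hi j hj => stairCore_top_right hn X Y hi hj) 0
  rw [adjugate_toSq_zero_zero] at hfac
  have hY : (toSq m fun i j => stairCore (m + 1) (K + 2) X Y i (j + 1)).det
      = detYbar (m + 1) Y := by
    refine congrArg Matrix.det ?_
    ext i j
    have := stairCore_block m K X Y (Nat.zero_le _) i.2 (Nat.zero_le (K + 1))
      (by omega : (j : ℕ) + 1 < m + 1)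
    simpa [toSq] using this
  rw [hY] at hfac
  refine Eq.trans ?_ (hfac.trans ?_)
  · rfl
  · congr 3
    ext i j
    rw [show m + 1 + 1 - 1 + i = m + (1 + i) by omega, show m + 1 + 1 - 1 + j = m + (1 + j) by omega]

/-- Divisibility form of `sum_coeff_det_pencil_eq_zero`, over any commutative ring. -/
theorem det_core_dvd {α : Type*} [CommRing α] {m K b : ℕ} (hn : K + 2 + b ≤ m + 1)
    (X Y : ℕ → ℕ → α) (hX : ∀ i j, K + 2 + b ≤ i ∨ j < b → X i j = 0)
    (hY : ∀ i j, K + 2 + b ≤ i → j < b → Y i j = 0) :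
    (toSq (m + (K * (m + 1) + b) + 1) (stairCore (m + 1) (K + 2) X Y)).det ∣
      ∑ i ∈ range (K + 3), (pencil (m + 1) X Y).det.coeff i * coreKer m K b X Y m ^ i
        * coreKer m K b X Y 0 ^ (K + 2 - i) := by
  set φ := (toSq (m + (K * (m + 1) + b) + 1) (stairCore (m + 1) (K + 2) X Y)).det with hφ
  set f := Ideal.Quotient.mk (Ideal.span {φ}) with hf
  set X' : ℕ → ℕ → α ⧸ Ideal.span {φ} := fun i j => f (X i j) with hX'
  set Y' : ℕ → ℕ → α ⧸ Ideal.span {φ} := fun i j => f (Y i j) with hY'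
  have hcore : (toSq (m + (K * (m + 1) + b) + 1) (stairCore (m + 1) (K + 2) X' Y'))
      = f.mapMatrix (toSq (m + (K * (m + 1) + b) + 1) (stairCore (m + 1) (K + 2) X Y)) := by
    ext i j
    simp only [toSq, stairCore, Matrix.of_apply, RingHom.mapMatrix_apply, Matrix.map_apply,
      apply_ite f, map_zero, hX', hY']
  have hker : ∀ r, coreKer m K b X' Y' r = f (coreKer m K b X Y r) := by
    intro r
    unfold coreKer
    split_ifs
    · rw [hcore, ← RingHom.map_adjugate]
      rfl
    · simp
  have hpencil : (pencil (m + 1) X' Y').det = Polynomial.map f (pencil (m + 1) X Y).det := by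
    rw [← Polynomial.coe_mapRingHom, RingHom.map_det]
    congr 1
    ext1 i j
    simp [pencil, hX', hY']
  have h := sum_coeff_det_pencil_eq_zero hn X' Y'
    (fun i j h => by simp [hX', hX i j h]) (fun i j h h' => by simp [hY', hY i j h h'])
    (by
      rw [hcore, ← RingHom.map_det, hf, Ideal.Quotient.eq_zero_iff_mem, ← hφ]
      exact Ideal.mem_span_singleton_self φ)
  rw [← Ideal.mem_span_singleton, ← Ideal.Quotient.eq_zero_iff_mem, ← hf, ← h, map_sum]
  refine Finset.sum_congr rfl fun i _ => ?_
  simp only [hker, hpencil, Polynomial.coeff_map, map_mul, map_pow]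

/-- Dehomogenization of `detLM` at `λ = 1`. -/
theorem eval₂_detLM {α : Type*} [CommRing α] (n : ℕ) (X Y : ℕ → ℕ → α) :
    MvPolynomial.eval₂Hom (Polynomial.C : α →+* Polynomial α) ![1, Polynomial.X]
      (detLM n X Y) = (pencil n X Y).det := by
  rw [detLM, RingHom.map_det]
  congr 1
  ext1 i j
  simp [pencil, toSq]

/-- for the generic staircase pair, the core determinant `φ_1` divides
`Σ_{i=0}^{k} c_i ((-1)^(n-1) det Ȳ · φ_{n+1})^i φ_2^(k-i)`. -/
theorem statement2 (n k b : ℕ) (hk : 2 ≤ k) (hn : k + b ≤ n) (c : ℕ → Rgen)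
    (hc : detLM n (genX n (k + b) b) (genY n (k + b) b)
        = (MvPolynomial.X 0 : MvPolynomial (Fin 2) Rgen) ^ (n - k)
          * ∑ i ∈ Finset.range (k + 1), MvPolynomial.C (c i)
              * (MvPolynomial.X 1 : MvPolynomial (Fin 2) Rgen) ^ i
              * (MvPolynomial.X 0 : MvPolynomial (Fin 2) Rgen) ^ (k - i)) :
    ∃ φstar : Rgen,
      sminor (stairCore n k (genX n (k + b) b) (genY n (k + b) b)) 1 ((k - 1) * n + b) * φstar
        = ∑ i ∈ Finset.range (k + 1), c i
            * ((-1 : Rgen) ^ (n - 1) * detYbar n (genY n (k + b) b)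
                * sminor (stairCore n k (genX n (k + b) b) (genY n (k + b) b)) (n + 1)
                    ((k - 1) * n + b)) ^ i
            * (sminor (stairCore n k (genX n (k + b) b) (genY n (k + b) b)) 2
                ((k - 1) * n + b)) ^ (k - i) := by
  obtain ⟨K, rfl⟩ : ∃ K, k = K + 2 := ⟨k - 2, by omega⟩
  obtain ⟨m, rfl⟩ : ∃ m, n = m + 1 := ⟨n - 1, by omega⟩
  set X := genX (m + 1) (K + 2 + b) b with hXdef
  set Y := genY (m + 1) (K + 2 + b) b with hYdef
  have hX : ∀ i j, K + 2 + b ≤ i ∨ j < b → X i j = 0 := by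
    intro i j h
    simp only [hXdef, genX]
    rw [if_neg (by omega)]
  have hY : ∀ i j, K + 2 + b ≤ i → j < b → Y i j = 0 := by
    intro i j h h'
    simp only [hYdef, genY]
    rw [if_neg (by omega)]
  have hcoeff : ∀ i < K + 3, (pencil (m + 1) X Y).det.coeff i = c i := by
    intro i hi
    have h := congrArg (MvPolynomial.eval₂Hom (Polynomial.C : Rgen →+* Polynomial Rgen)
      ![1, Polynomial.X]) hc
    rw [eval₂_detLM] at h
    rw [h]
    simp only [map_mul, map_pow, map_sum, MvPolynomial.coe_eval₂Hom, MvPolynomial.eval₂_X,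
      MvPolynomial.eval₂_C, Matrix.cons_val_zero, Matrix.cons_val_one, one_pow, one_mul, mul_one,
      Polynomial.finsetSum_coeff, Polynomial.coeff_C_mul_X_pow, Finset.sum_ite_eq,
      Finset.mem_range]
    rw [if_pos hi]
  obtain ⟨d, hd⟩ := det_core_dvd hn X Y hX hY
  refine ⟨d, ?_⟩
  have hsize : (K + 1) * (m + 1) + b + 1 - 1 = m + (K * (m + 1) + b) + 1 := by
    rw [add_mul K 1]; omega
  have h1 : sminor (stairCore (m + 1) (K + 2) X Y) 1 ((K + 1) * (m + 1) + b)
      = (toSq (m + (K * (m + 1) + b) + 1) (stairCore (m + 1) (K + 2) X Y)).det := by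
    rw [sminor_eq_det_toSq _ hsize]
    simp only [Nat.sub_self, zero_add]
  simp only [show K + 2 - 1 = K + 1 from rfl, Nat.add_sub_cancel]
  rw [h1, ← hd, ← coreKer_zero, ← coreKer_block_start hn]
  refine Finset.sum_congr rfl fun i hi => ?_
  rw [hcoeff i (Finset.mem_range.1 hi)]

end
end

section
/- For every integer k ≥ 2 and every γ ∈ ℂ there exists an invertible complex k×k matrix A, all of whose leading principal minors are nonzero, such that det K(A; e_1) = 0 but det K*(A; e_1, A^{−1}(e_2 + γe_1)) ≠ 0. -/
open Matrix Finset

noncomputable section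

/-- The transposition of `0` and `1` on the natural numbers. -/
def swapZeroOne (i : ℕ) : ℕ := if i = 0 then 1 else if i = 1 then 0 else i

theorem swapZeroOne_swapZeroOne (i : ℕ) : swapZeroOne (swapZeroOne i) = i := by
  unfold swapZeroOne; split_ifs <;> grind

theorem swapZeroOne_lt {k i : ℕ} (hk : 2 ≤ k) (hi : i < k) : swapZeroOne i < k := by
  unfold swapZeroOne; split_ifs <;> omega

theorem swapZeroOne_injective : Function.Injective swapZeroOne :=
  Function.LeftInverse.injective swapZeroOne_swapZeroOne

/-- `swapZeroOne` as a permutation of `Fin k`. -/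
def finSwap {k : ℕ} (hk : 2 ≤ k) : Equiv.Perm (Fin k) :=
  Function.Involutive.toPerm (fun i => ⟨swapZeroOne i, swapZeroOne_lt hk i.isLt⟩)
    fun i => Fin.ext (swapZeroOne_swapZeroOne i)

theorem coe_finSwap {k : ℕ} (hk : 2 ≤ k) (i : Fin k) :
    ((finSwap hk i : Fin k) : ℕ) = swapZeroOne i := rfl

theorem swapZeroOne_eq_iff {k n : ℕ} (hk : 2 ≤ k) (hn : n < k) (i : Fin k) :
    swapZeroOne i = n ↔ i = finSwap hk ⟨n, hn⟩ := by
  rw [Fin.ext_iff, coe_finSwap, ← swapZeroOne_injective.eq_iff (a := (i : ℕ)),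
    swapZeroOne_swapZeroOne]

/-- The nilpotent Jordan block for the ordered basis `e_2, e_1, e_3, …, e_k`. -/
def shiftMat (k : ℕ) : Matrix (Fin k) (Fin k) ℂ :=
  Matrix.of fun i j => if swapZeroOne i = swapZeroOne j + 1 then 1 else 0

theorem shiftMat_pow_apply {k : ℕ} (hk : 2 ≤ k) (n : ℕ) (i j : Fin k) :
    (shiftMat k ^ n) i j = if swapZeroOne i = swapZeroOne j + n then 1 else 0 := by
  induction n generalizing j with
  | zero =>
    simp [Matrix.one_apply, swapZeroOne_injective.eq_iff, Fin.ext_iff]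
  | succ n ih =>
    rw [pow_succ, Matrix.mul_apply]
    simp only [ih]
    by_cases hj : swapZeroOne j + 1 < k
    · rw [Finset.sum_eq_single (finSwap hk ⟨swapZeroOne j + 1, hj⟩)]
      · simp [shiftMat, coe_finSwap, swapZeroOne_swapZeroOne, add_assoc, add_comm 1 n]
      · intro c _ hc
        have : swapZeroOne c ≠ swapZeroOne j + 1 := mt (swapZeroOne_eq_iff hk hj c).mp hc
        simp [shiftMat, this]
      · simp
    · have hi := swapZeroOne_lt hk i.isLt
      rw [if_neg (by omega), Finset.sum_eq_zero]
      intro c _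
      have hc := swapZeroOne_lt hk c.isLt
      have : swapZeroOne c ≠ swapZeroOne j + 1 := by omega
      simp [shiftMat, this]

theorem det_one_add_shiftMat {k : ℕ} (hk : 1 ≤ k) : (1 + shiftMat k).det = 1 := by
  obtain rfl | hk := hk.eq_or_lt
  · simp [shiftMat]
  · replace hk : 2 ≤ k := hk
    rw [← Matrix.det_submatrix_equiv_self (finSwap hk), Matrix.det_of_isLowerTriangular]
    · apply Finset.prod_eq_one
      intro i _
      simp [shiftMat]
    · intro i j hij
      have hij' : (i : ℕ) < j := hij
      simp only [Matrix.submatrix_apply, Matrix.add_apply, Matrix.one_apply, shiftMat,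
        Matrix.of_apply, coe_finSwap, swapZeroOne_swapZeroOne, (finSwap hk).injective.eq_iff]
      rw [if_neg (fun h => by omega), if_neg (by omega), add_zero]

theorem submatrix_one_add_shiftMat {k m : ℕ} (hmk : m ≤ k) :
    (1 + shiftMat k).submatrix (Fin.castLE hmk) (Fin.castLE hmk) = 1 + shiftMat m := by
  ext i j
  simp [shiftMat, Matrix.one_apply, Fin.ext_iff]

/-- A linear functional vanishing on `A ^ j` for `j < n` agrees on `(A - 1) ^ n` and `A ^ n`. -/
theorem map_sub_one_pow_eq {R M : Type*} [Ring R] [AddCommGroup M] (φ : R →+ M) (a : R) (n : ℕ)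
    (h : ∀ j < n, φ (a ^ j) = 0) : φ ((a - 1) ^ n) = φ (a ^ n) := by
  rw [sub_eq_add_neg, ((Commute.one_right a).neg_right).add_pow, map_sum,
    Finset.sum_range_succ, Finset.sum_eq_zero, zero_add]
  · simp
  · intro j hj
    have : a ^ j * (-1) ^ (n - j) * (n.choose j : R) =
        ((-1 : ℤ) ^ (n - j) * n.choose j) • a ^ j := by
      rw [zsmul_eq_mul', mul_assoc]; push_cast; rfl
    rw [this, map_zsmul, h j (Finset.mem_range.mp hj), smul_zero]

/-- The additive functional `B ↦ y ⬝ B x` on matrices. -/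
def bilinHom {k : ℕ} (y x : Fin k → ℂ) : Matrix (Fin k) (Fin k) ℂ →+ ℂ where
  toFun B := y ⬝ᵥ B *ᵥ x
  map_zero' := by simp
  map_add' := by intro B C; simp [Matrix.add_mulVec]

theorem dotProduct_shiftMat_pow_eq {k : ℕ} (y x : Fin k → ℂ) (n : ℕ)
    (h : ∀ j < n, y ⬝ᵥ (1 + shiftMat k) ^ j *ᵥ x = 0) :
    y ⬝ᵥ shiftMat k ^ n *ᵥ x = y ⬝ᵥ (1 + shiftMat k) ^ n *ᵥ x := by
  have := map_sub_one_pow_eq (bilinHom y x) (1 + shiftMat k) n h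
  rwa [add_sub_cancel_left] at this

theorem basisVec_eq_single {k m : ℕ} (hm : m < k) :
    basisVec k m = Pi.single (⟨m, hm⟩ : Fin k) 1 := by
  ext i
  simp [basisVec, Pi.single_apply, Fin.ext_iff]

theorem dotProduct_shiftMat_pow_basisVec {k : ℕ} (hk : 2 ≤ k) (y : Fin k → ℂ) {n : ℕ}
    (hn : n + 1 < k) :
    y ⬝ᵥ shiftMat k ^ n *ᵥ basisVec k 0 = y (finSwap hk ⟨n + 1, hn⟩) := by
  rw [basisVec_eq_single (by omega), Matrix.mulVec_single_one, dotProduct,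
    Finset.sum_eq_single (finSwap hk ⟨n + 1, hn⟩)]
  · simp only [Matrix.col_apply, shiftMat_pow_apply hk, coe_finSwap, swapZeroOne_swapZeroOne]
    simp [swapZeroOne, add_comm]
  · intro i _ hi
    simp only [Matrix.col_apply, shiftMat_pow_apply hk]
    rw [if_neg, mul_zero]
    intro h
    exact hi ((swapZeroOne_eq_iff hk hn i).mp (h.trans (by simp [swapZeroOne, add_comm])))
  · simp

theorem one_add_shiftMat_row_one {k : ℕ} (hk : 2 ≤ k) (x : Fin k → ℂ) :
    ((1 + shiftMat k) *ᵥ x) ⟨1, hk⟩ = x ⟨1, hk⟩ := by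
  have : (shiftMat k *ᵥ x) ⟨1, hk⟩ = 0 := by
    simp [Matrix.mulVec, dotProduct, shiftMat, swapZeroOne]
  simp [Matrix.add_mulVec, this]

theorem one_add_shiftMat_pow_row_one {k : ℕ} (hk : 2 ≤ k) (x : Fin k → ℂ) (n : ℕ) :
    ((1 + shiftMat k) ^ n *ᵥ x) ⟨1, hk⟩ = x ⟨1, hk⟩ := by
  induction n with
  | zero => simp
  | succ n ih => rw [pow_succ', ← Matrix.mulVec_mulVec, one_add_shiftMat_row_one, ih]

theorem det_Kmat_one_add_shiftMat {k : ℕ} (hk : 2 ≤ k) :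
    (Kmat k (1 + shiftMat k) (basisVec k 0)).det = 0 := by
  apply Matrix.det_eq_zero_of_row_eq_zero ⟨1, hk⟩
  intro j
  rw [Kmat, Matrix.of_apply, one_add_shiftMat_pow_row_one]
  simp [basisVec]

theorem vecMul_K1mat_zero {k : ℕ} (hk : 2 ≤ k) (A : Matrix (Fin k) (Fin k) ℂ)
    (u v y : Fin k → ℂ) : (y ᵥ* K1mat k A u v) ⟨0, by omega⟩ = y ⬝ᵥ v := by
  simp [Matrix.vecMul, dotProduct, K1mat]

theorem vecMul_K1mat_succ {k : ℕ} (A : Matrix (Fin k) (Fin k) ℂ)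
    (u v y : Fin k → ℂ) {n : ℕ} (hn : n + 1 < k) :
    (y ᵥ* K1mat k A u v) ⟨n + 1, hn⟩ = y ⬝ᵥ A ^ n *ᵥ u := by
  simp [Matrix.vecMul, dotProduct, K1mat]

theorem det_K1mat_one_add_shiftMat_ne_zero {k : ℕ} (hk : 2 ≤ k) {v : Fin k → ℂ}
    (hv : v ⟨1, hk⟩ ≠ 0) : (K1mat k (1 + shiftMat k) (basisVec k 0) v).det ≠ 0 := by
  intro hdet
  obtain ⟨y, hy0, hy⟩ := Matrix.exists_vecMul_eq_zero_iff.mpr hdet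
  have hA : ∀ n, n + 1 < k → y ⬝ᵥ (1 + shiftMat k) ^ n *ᵥ basisVec k 0 = 0 := by
    intro n hn
    rw [← vecMul_K1mat_succ _ _ v y hn, hy, Pi.zero_apply]
  have hzero : ∀ i : Fin k, i ≠ ⟨1, hk⟩ → y i = 0 := by
    intro i hi
    have hlt := swapZeroOne_lt hk i.isLt
    have hne : swapZeroOne i ≠ 0 := by
      intro h
      apply hi
      ext
      rw [← swapZeroOne_swapZeroOne i, h]
      rfl
    obtain ⟨n, hn⟩ := Nat.exists_eq_succ_of_ne_zero hne
    have hn' : n + 1 < k := by omega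
    rw [(swapZeroOne_eq_iff hk hn' i).mp hn, ← dotProduct_shiftMat_pow_basisVec hk y hn',
      dotProduct_shiftMat_pow_eq y _ n fun j hj => hA j (by omega), hA n hn']
  have hyv : y ⬝ᵥ v = 0 := by
    rw [← vecMul_K1mat_zero hk (1 + shiftMat k) (basisVec k 0) v y, hy, Pi.zero_apply]
  rw [dotProduct, Finset.sum_eq_single ⟨1, hk⟩ (fun i _ hi => by rw [hzero i hi, zero_mul])
    (by simp)] at hyv
  apply hy0
  ext i
  by_cases hi : i = ⟨1, hk⟩
  · rw [hi]
    exact (mul_eq_zero.mp hyv).resolve_right hv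
  · exact hzero i hi

theorem wRow_vecMul_K1mat {k : ℕ} (A : Matrix (Fin k) (Fin k) ℂ) (u v : Fin k → ℂ) (j : Fin k) :
    (wRow k A u v ᵥ* K1mat k A u v) j = if (j : ℕ) = k - 1 then (K1mat k A u v).det else 0 := by
  have h := congrFun (congrFun (Matrix.adjugate_mul (K1mat k A u v))
    ⟨k - 1, by have := j.isLt; omega⟩) j
  rw [Matrix.mul_apply] at h
  simp only [Matrix.vecMul, dotProduct, wRow]
  rw [h]
  simp [Matrix.one_apply, Fin.ext_iff, eq_comm]

theorem wRow_last_ne_zero {k : ℕ} (hk : 2 ≤ k) {v : Fin k → ℂ} (hv : v ⟨1, hk⟩ ≠ 0) :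
    wRow k (1 + shiftMat k) (basisVec k 0) v (finSwap hk ⟨k - 1, by omega⟩) ≠ 0 := by
  obtain ⟨l, rfl⟩ := Nat.exists_eq_add_of_le' hk
  have h := dotProduct_shiftMat_pow_basisVec hk
    (wRow (l + 2) (1 + shiftMat (l + 2)) (basisVec (l + 2) 0) v) (n := l) (by omega)
  change _ = wRow _ _ _ _ (finSwap hk ⟨l + 2 - 1, _⟩) at h
  rw [← h, dotProduct_shiftMat_pow_eq, ← vecMul_K1mat_succ _ _ v _ (by omega), wRow_vecMul_K1mat,
    if_pos (by simp)]
  · exact det_K1mat_one_add_shiftMat_ne_zero hk hv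
  · intro j hj
    rw [← vecMul_K1mat_succ _ _ v _ (by omega), wRow_vecMul_K1mat, if_neg (by simp; omega)]

theorem det_rows_one_add_shiftMat_ne_zero {k : ℕ} (hk : 2 ≤ k) {w : Fin k → ℂ}
    (hw : w (finSwap hk ⟨k - 1, by omega⟩) ≠ 0) :
    (Matrix.of fun i : Fin k => w ᵥ* (1 + shiftMat k) ^ (i : ℕ)).det ≠ 0 := by
  intro hdet
  obtain ⟨x, hx0, hx⟩ := Matrix.exists_mulVec_eq_zero_iff.mpr hdet
  have hA : ∀ n < k, w ⬝ᵥ (1 + shiftMat k) ^ n *ᵥ x = 0 := by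
    intro n hn
    rw [Matrix.dotProduct_mulVec]
    exact congrFun hx ⟨n, hn⟩
  have hN : ∀ n < k, w ⬝ᵥ shiftMat k ^ n *ᵥ x = 0 := by
    intro n hn
    rw [dotProduct_shiftMat_pow_eq w x n fun j hj => hA j (by omega), hA n hn]
  have key : ∀ n, ∀ hn : n < k, x (finSwap hk ⟨n, hn⟩) = 0 := by
    intro n
    induction n using Nat.strong_induction_on with
    | _ n ih =>
      intro hn
      have hlow : ∀ j : Fin k, swapZeroOne j < n → x j = 0 := by
        intro j hj
        rw [(swapZeroOne_eq_iff hk (hj.trans hn) j).mp rfl]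
        exact ih _ hj _
      have hcol : shiftMat k ^ (k - 1 - n) *ᵥ x =
          Pi.single (finSwap hk ⟨k - 1, by omega⟩) (x (finSwap hk ⟨n, hn⟩)) := by
        ext i
        rw [Matrix.mulVec, dotProduct, Finset.sum_eq_single (finSwap hk ⟨n, hn⟩)]
        · rw [shiftMat_pow_apply hk, coe_finSwap, swapZeroOne_swapZeroOne, Pi.single_apply]
          rw [Nat.add_sub_cancel' (by omega : n ≤ k - 1)]
          simp [swapZeroOne_eq_iff hk (by omega : k - 1 < k)]
        · intro j _ hj
          have hj' : swapZeroOne j ≠ n := mt (swapZeroOne_eq_iff hk hn j).mp hj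
          rcases lt_or_gt_of_ne hj' with h | h
          · rw [hlow j h, mul_zero]
          · have := swapZeroOne_lt hk i.isLt
            rw [shiftMat_pow_apply hk, if_neg (by omega), zero_mul]
        · simp
      have h := hN (k - 1 - n) (by omega)
      rw [hcol, dotProduct_single] at h
      exact (mul_eq_zero.mp h).resolve_left hw
  apply hx0
  ext j
  rw [← (finSwap hk).apply_symm_apply j]
  exact key _ _

/-- moreover, `A` can be chosen with all leading principal minors nonzero. -/
theorem statement5 (k : ℕ) (hk : 2 ≤ k) (γ : ℂ) :
    ∃ A : Matrix (Fin k) (Fin k) ℂ, IsUnit A.det ∧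
      (∀ m, 1 ≤ m → ∀ hmk : m ≤ k,
        (A.submatrix (Fin.castLE hmk) (Fin.castLE hmk)).det ≠ 0) ∧
      (Kmat k A (basisVec k 0)).det = 0 ∧
      (Kstar k A (basisVec k 0)
        (A⁻¹.mulVec (basisVec k 1 + γ • basisVec k 0))).det ≠ 0 := by
  have hdet := det_one_add_shiftMat (k := k) (by omega)
  have hunit : IsUnit (1 + shiftMat k).det := by rw [hdet]; exact isUnit_one
  refine ⟨1 + shiftMat k, hunit, ?_, det_Kmat_one_add_shiftMat hk, ?_⟩
  · intro m hm hmk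
    rw [submatrix_one_add_shiftMat, det_one_add_shiftMat hm]
    exact one_ne_zero
  · apply det_rows_one_add_shiftMat_ne_zero hk
    apply wRow_last_ne_zero hk
    rw [← one_add_shiftMat_row_one hk (_ *ᵥ _), Matrix.mulVec_mulVec, Matrix.mul_nonsing_inv _ hunit,
      Matrix.one_mulVec]
    simp [basisVec]

end
end

section
/- Under the staircase hypotheses, assume Y is invertible and Y2 is invertible. Then the core determinant satisfies φ_1 = ε_1 · (det Y)^{k−1} · det Y_2 · det[U^{k−1}e_1, U^{k−2}e_1, …, U e_1, e_1], where ε_1 = (−1)^{n·k(k−1)/2}, e_1 = (1,0,…,0) ∈ ℂ^k, and [U^{k−1}e_1, …, e_1] denotes the k×k matrix with the indicated columns. -/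
open Matrix Finset

noncomputable section

/-- Laplace expansion of an `ℕ`-indexed matrix along a column which is a standard basis vector. -/
lemma det_natIndexed_of_col_eq_single (m : ℕ) (F : ℕ → ℕ → ℂ) (r₀ c₀ : ℕ) (hr : r₀ < m + 1)
    (hc : c₀ < m + 1) (h : ∀ r < m + 1, F r c₀ = if r = r₀ then 1 else 0) :
    (Matrix.of fun i j : Fin (m + 1) => F i j).det
      = (-1) ^ (r₀ + c₀) * (Matrix.of fun i j : Fin m =>
          F (if (i : ℕ) < r₀ then i else i + 1) (if (j : ℕ) < c₀ then j else j + 1)).det := by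
  rw [Matrix.det_succ_column _ (⟨c₀, hc⟩ : Fin (m + 1)),
    Finset.sum_eq_single (⟨r₀, hr⟩ : Fin (m + 1))]
  · simp only [Matrix.of_apply, h r₀ hr, if_true, mul_one]
    congr 2
    ext i j
    have key : ∀ (p : ℕ) (hp : p < m + 1) (i : Fin m),
        (((⟨p, hp⟩ : Fin (m + 1)).succAbove i : Fin (m + 1)) : ℕ)
          = if (i : ℕ) < p then (i : ℕ) else i + 1 := by
      intro p hp i
      simp only [Fin.succAbove, Fin.lt_def, Fin.val_castSucc]
      split_ifs <;> simp
    simp [key]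
  · intro r _ hne
    have : (r : ℕ) ≠ r₀ := fun h' => hne (Fin.ext h')
    simp [h r r.2, this]
  · simp

/-- The core bordered by `k = m + 1` columns, the `j`-th of which is the first basis vector of the
`j`-th block row; the first row of `X` and `Y` is restored in each block row. -/
def borderedCore (n m : ℕ) (X Y : ℕ → ℕ → ℂ) : ℕ → ℕ → ℂ := fun r c =>
  if c < m * n then
    if c / n = r / n then Y (r % n) (c % n)
    else if c / n + 1 = r / n then X (r % n) (c % n)
    else 0
  else if c < m * n + (m + 1) then
    if r = (c - m * n) * n then 1 else 0
  else if m * n ≤ r then Y (r - m * n) (c - (m * n + (m + 1)))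
  else 0

/-- Row selection omitting the first rows of the first `j` blocks of size `q + 1`. -/
def skipRows (q j r : ℕ) : ℕ := if r < j * q then r / q * (q + 1) + r % q + 1 else r + j

/-- Column selection omitting the `j` columns starting at `p`. -/
def skipCols (p j c : ℕ) : ℕ := if c < p then c else c + j

lemma skipRows_succ (q j r : ℕ) (hq : 0 < q) :
    skipRows q j (if r < j * q then r else r + 1) = skipRows q (j + 1) r := by
  unfold skipRows
  by_cases h : r < j * q
  · have : r < (j + 1) * q := by nlinarith
    simp [h, this]
  · have h2 : ¬ (r + 1 < j * q) := by omega
    simp only [h, h2, if_false]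
    split_ifs with h3
    · have hd : r / q = j := by
        apply Nat.div_eq_of_lt_le <;> omega
      have := Nat.div_add_mod r q
      rw [hd] at this ⊢
      nlinarith
    · omega

lemma det_borderedCore_eq_prod_mul_det_skip (q m b : ℕ) (hq : 0 < q) (X Y : ℕ → ℕ → ℂ) (j l : ℕ)
    (hjl : j + l = m + 1) :
    (Matrix.of fun r c : Fin (m * (q + 1) + b + (m + 1)) =>
        borderedCore (q + 1) m X Y r c).det
      = (∏ i ∈ Finset.range j, (-1 : ℂ) ^ (i * q + m * (q + 1))) *
        (Matrix.of fun r c : Fin (m * (q + 1) + b + l) =>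
          borderedCore (q + 1) m X Y (skipRows q j r) (skipCols (m * (q + 1)) j c)).det := by
  induction j generalizing l with
  | zero =>
    obtain rfl : l = m + 1 := by omega
    simp [skipRows, skipCols]
  | succ j ih =>
    rw [ih (l + 1) (by omega), Finset.prod_range_succ, mul_assoc]
    congr 1
    have hjm : j * q ≤ m * q := Nat.mul_le_mul_right _ (by omega)
    have e := det_natIndexed_of_col_eq_single (m * (q + 1) + b + l)
      (fun r c => borderedCore (q + 1) m X Y (skipRows q j r) (skipCols (m * (q + 1)) j c))
      (j * q) (m * (q + 1)) (by nlinarith) (by omega) ?_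
    · refine Eq.trans e ?_
      congr 2
      ext r c
      simp only [Matrix.of_apply]
      rw [skipRows_succ q j r hq]
      congr 1
      unfold skipCols
      split_ifs <;> omega
    · intro r hr
      have hc : skipCols (m * (q + 1)) j (m * (q + 1)) = m * (q + 1) + j := by simp [skipCols]
      simp only [hc]
      have h1 : ¬ (m * (q + 1) + j < m * (q + 1)) := by omega
      have h2 : m * (q + 1) + j < m * (q + 1) + (m + 1) := by omega
      simp only [borderedCore, h1, h2, if_false, if_true, Nat.add_sub_cancel_left]
      congr 1
      apply propext
      unfold skipRows
      split_ifs with h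
      · constructor
        · intro h'
          exfalso
          have h4 : r / q < j := Nat.div_lt_of_lt_mul (by rwa [mul_comm])
          have h5 : r % q < q := Nat.mod_lt _ hq
          have h6 : (r / q + 1) * (q + 1) ≤ j * (q + 1) := Nat.mul_le_mul_right _ h4
          nlinarith
        · omega
      · constructor <;> intro h' <;> nlinarith

lemma stairCore_eq_borderedCore (q m b : ℕ) (hq : 0 < q) (hm : 0 < m) (hb : m + 1 + b ≤ q + 1)
    (X Y : ℕ → ℕ → ℂ) (r c : ℕ) (hr : r < m * (q + 1) + b) (hc : c < m * (q + 1) + b) :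
    stairCore (q + 1) (m + 1) X Y r c
      = borderedCore (q + 1) m X Y (skipRows q (m + 1) r)
          (skipCols (m * (q + 1)) (m + 1) c) := by
  have hr' : r < (m + 1) * q := by nlinarith
  have hrow : skipRows q (m + 1) r = r / q * (q + 1) + (r % q + 1) := by
    simp [skipRows, hr', add_assoc]
  have hs : r % q < q := Nat.mod_lt _ hq
  have hi : r / q < m + 1 := Nat.div_lt_of_lt_mul (by rwa [mul_comm])
  have hd : (r / q * (q + 1) + (r % q + 1)) / (q + 1) = r / q := by
    rw [add_comm, Nat.add_mul_div_right _ _ (by omega), Nat.div_eq_of_lt (by omega), zero_add]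
  have hmod : (r / q * (q + 1) + (r % q + 1)) % (q + 1) = r % q + 1 := by
    rw [add_comm, Nat.add_mul_mod_self_right, Nat.mod_eq_of_lt (by omega)]
  have hrd := Nat.div_add_mod r q
  have hiff : r / q < m ↔ r < m * q := Nat.div_lt_iff_lt_mul hq
  rw [hrow]
  simp only [stairCore, borderedCore, hd, hmod, Nat.add_sub_cancel]
  rw [show m + 1 - 2 = m - 1 by omega]
  have hcd := Nat.div_add_mod c (q + 1)
  have hct : c % (q + 1) < q + 1 := Nat.mod_lt _ (by omega)
  generalize r / q = i at *
  generalize r % q = s at *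
  by_cases hcm : c < m * (q + 1)
  · have hsc : skipCols (m * (q + 1)) (m + 1) c = c := by simp [skipCols, hcm]
    rw [hsc]
    simp only [hcm, if_true]
    have hj : c / (q + 1) < m := Nat.div_lt_of_lt_mul (by rwa [mul_comm])
    generalize c / (q + 1) = j at *
    generalize c % (q + 1) = t at *
    subst hcd
    have bl : ∀ x : ℕ, (x * (q + 1) ≤ (q + 1) * j + t ∧ (q + 1) * j + t < x * (q + 1) + (q + 1))
        ↔ j = x := by
      intro x
      constructor
      · rintro ⟨h1, h2⟩
        rcases lt_trichotomy j x with h | h | h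
        · have := Nat.mul_le_mul_right (q + 1) (Nat.succ_le_of_lt h)
          rw [Nat.succ_eq_add_one] at this
          linarith
        · exact h
        · have := Nat.mul_le_mul_right (q + 1) (Nat.succ_le_of_lt h)
          rw [Nat.succ_eq_add_one] at this
          linarith
      · rintro rfl
        constructor <;> nlinarith
    have sb : ∀ x : ℕ, j = x → (q + 1) * j + t - x * (q + 1) = t := by
      rintro x rfl
      rw [mul_comm, Nat.add_sub_cancel_left]
    have up : ∀ x : ℕ, 1 ≤ x → x * (q + 1) = (x - 1) * (q + 1) + (q + 1) := by
      intro x hx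
      obtain ⟨y, rfl⟩ := Nat.exists_eq_add_of_le' hx
      simp [add_mul]
    by_cases hri : r < m * q
    · simp only [hri, if_true]
      by_cases hji : j = i
      · rw [if_pos ((bl i).2 hji), if_pos hji, sb i hji]
      · rw [if_neg (fun h => hji ((bl i).1 h)), if_neg hji]
        by_cases hji' : j + 1 = i
        · rw [if_pos hji', if_pos, sb (i - 1) (by omega)]
          refine ⟨by omega, ?_⟩
          rw [up i (by omega)]
          exact (bl (i - 1)).2 (by omega)
        · rw [if_neg hji', if_neg]
          rintro ⟨h1, h2⟩
          rw [up i h1] at h2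
          have := (bl (i - 1)).1 h2
          omega
    · have him : i = m := by omega
      subst him
      have hrs : r - i * q = s := by rw [← hrd, mul_comm, Nat.add_sub_cancel_left]
      simp only [hri, if_false, hrs]
      rw [if_neg (show j ≠ i by omega), if_neg (show ¬ i * (q + 1) ≤ (q + 1) * j + t by omega)]
      by_cases hji' : j + 1 = i
      · rw [if_pos hji', if_pos, sb (i - 1) (by omega)]
        exact ⟨((bl (i - 1)).2 (by omega)).1, trivial⟩
      · rw [if_neg hji', if_neg]
        rintro ⟨h2, -⟩
        have := (bl (i - 1)).1 ⟨h2, by rwa [← up i hm]⟩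
        omega
  · have hsc : skipCols (m * (q + 1)) (m + 1) c = c + (m + 1) := by simp [skipCols, hcm]
    rw [hsc]
    rw [if_neg (show ¬ c + (m + 1) < m * (q + 1) by omega),
      if_neg (show ¬ c + (m + 1) < m * (q + 1) + (m + 1) by omega),
      show c + (m + 1) - (m * (q + 1) + (m + 1)) = c - m * (q + 1) by omega]
    by_cases hri : r < m * q
    · have him : i + 1 ≤ m := by omega
      have hle : (i + 1) * (q + 1) ≤ m * (q + 1) := Nat.mul_le_mul_right _ him
      have hle' : i * (q + 1) + (q + 1) ≤ m * (q + 1) := by linarith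
      rw [if_pos hri, if_neg (by omega), if_neg (by omega), if_neg (by omega)]
    · have him : i = m := by omega
      subst him
      have hrs : r - i * q = s := by rw [← hrd, mul_comm, Nat.add_sub_cancel_left]
      rw [if_neg hri, if_neg (by omega), if_pos (by omega), if_pos (by omega), hrs,
        Nat.add_sub_cancel_left]

/-- Block elimination: if `A * T = B`, the Schur complement of `A` is `D - C * T`. -/
lemma det_fromBlocks_of_mul_eq {p r : Type*} [Fintype p] [Fintype r] [DecidableEq p]
    [DecidableEq r] (A : Matrix p p ℂ) (B : Matrix p r ℂ) (C : Matrix r p ℂ) (D : Matrix r r ℂ)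
    (T : Matrix p r ℂ) (h : A * T = B) :
    (Matrix.fromBlocks A B C D).det = A.det * (D - C * T).det := by
  have : Matrix.fromBlocks A B C D
      = Matrix.fromBlocks A 0 C (D - C * T) * Matrix.fromBlocks 1 T 0 1 := by
    simp [Matrix.fromBlocks_multiply, h]
  rw [this, Matrix.det_mul, Matrix.det_fromBlocks_zero₁₂, Matrix.det_fromBlocks_zero₂₁]
  simp

/-- The block lower bidiagonal matrix with diagonal blocks `Y` and subdiagonal blocks `X`. -/
def bidiag (n m : ℕ) (X Y : Matrix (Fin n) (Fin n) ℂ) :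
    Matrix (Fin m × Fin n) (Fin m × Fin n) ℂ :=
  Matrix.of fun r c => if c.1 = r.1 then Y r.2 c.2
    else if (c.1 : ℕ) + 1 = r.1 then X r.2 c.2 else 0

lemma det_bidiag (n m : ℕ) (X Y : Matrix (Fin n) (Fin n) ℂ) :
    (bidiag n m X Y).det = Y.det ^ m := by
  have ht : (bidiag n m X Y).BlockTriangular
      (fun x : Fin m × Fin n => OrderDual.toDual x.1) := by
    intro r c hlt
    have hlt' : r.1 < c.1 := hlt
    have h1 : c.1 ≠ r.1 := hlt'.ne'
    have h2 : (c.1 : ℕ) + 1 ≠ r.1 := by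
      have := Fin.lt_def.1 hlt'
      omega
    simp [bidiag, h1, h2]
  rw [ht.det_fintype]
  have hk : ∀ i : (Fin m)ᵒᵈ, ((bidiag n m X Y).toSquareBlock
      (fun x : Fin m × Fin n => OrderDual.toDual x.1) i).det = Y.det := by
    intro i
    let e : Fin n ≃ {x : Fin m × Fin n // OrderDual.toDual x.1 = i} :=
      { toFun := fun s => ⟨(OrderDual.ofDual i, s), rfl⟩
        invFun := fun x => x.1.2
        left_inv := fun s => rfl
        right_inv := by
          rintro ⟨⟨x, s⟩, rfl⟩
          rfl }
    rw [← Matrix.det_submatrix_equiv_self e]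
    congr 1
    ext s t
    simp [Matrix.toSquareBlock, Matrix.toSquareBlockProp, bidiag, e]
  simp [hk]

/-- The product `(-W)^j e₁` of the powers of `-X * Y⁻¹` with the first basis vector. -/
def krylov (n : ℕ) (X Y : Matrix (Fin n) (Fin n) ℂ) (j : ℕ) : Fin n → ℂ :=
  ((-(X * Y⁻¹)) ^ j).mulVec (basisVec n 0)

lemma krylov_succ (n : ℕ) (X Y : Matrix (Fin n) (Fin n) ℂ) (j : ℕ) :
    krylov n X Y (j + 1) = -X.mulVec (Y⁻¹.mulVec (krylov n X Y j)) := by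
  simp [krylov, pow_succ', ← Matrix.mulVec_mulVec, Matrix.neg_mulVec]

/-- The inclusion of the first `k + b` row indices. -/
def leadIdx (n k b : ℕ) (h : k + b ≤ n) : Fin k ⊕ Fin b → Fin n :=
  Sum.elim (fun i => Fin.castLE (by omega) i)
    (fun i => ⟨k + (i : ℕ), by have := i.isLt; omega⟩)

/-- The Schur complement of the bidiagonal block in the bordered core. -/
def krylovBlock (n m b : ℕ) (h : m + 1 + b ≤ n) (X Y : Matrix (Fin n) (Fin n) ℂ) :
    Matrix (Fin (m + 1) ⊕ Fin b) (Fin (m + 1) ⊕ Fin b) ℂ :=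
  Matrix.of fun r c => Sum.elim (fun j : Fin (m + 1) => krylov n X Y (m - j) (leadIdx n _ b h r))
    (fun y : Fin b => Y (leadIdx n _ b h r) (Fin.castLE (by omega) y)) c

/-- The solution of the block bidiagonal system whose right-hand sides are the bordering columns. -/
def bidiagSol (n m b : ℕ) (X Y : Matrix (Fin n) (Fin n) ℂ) :
    Matrix (Fin m × Fin n) (Fin (m + 1) ⊕ Fin b) ℂ :=
  Matrix.of fun r c => Sum.elim (fun j : Fin (m + 1) =>
    if (j : ℕ) ≤ r.1 then Y⁻¹.mulVec (krylov n X Y (r.1 - j)) r.2 else 0) (fun _ => 0) c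

/-- The bordering columns, restricted to the first `m` block rows. -/
def borderTop (n m b : ℕ) : Matrix (Fin m × Fin n) (Fin (m + 1) ⊕ Fin b) ℂ :=
  Matrix.of fun r c => Sum.elim (fun j : Fin (m + 1) =>
    if (j : ℕ) = r.1 then basisVec n 0 r.2 else 0) (fun _ => 0) c

/-- The last rows of the bordered core, in the first `m` block columns. -/
def lastRows (n m b : ℕ) (h : m + 1 + b ≤ n) (X : Matrix (Fin n) (Fin n) ℂ) :
    Matrix (Fin (m + 1) ⊕ Fin b) (Fin m × Fin n) ℂ :=
  Matrix.of fun r c => if (c.1 : ℕ) + 1 = m then X (leadIdx n _ b h r) c.2 else 0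

/-- The last rows of the bordered core, in the last columns. -/
def lastCorner (n m b : ℕ) (h : m + 1 + b ≤ n) (Y : Matrix (Fin n) (Fin n) ℂ) :
    Matrix (Fin (m + 1) ⊕ Fin b) (Fin (m + 1) ⊕ Fin b) ℂ :=
  Matrix.of fun r c => Sum.elim (fun j : Fin (m + 1) =>
      if (j : ℕ) = m then basisVec n 0 (leadIdx n _ b h r) else 0)
    (fun y : Fin b => Y (leadIdx n _ b h r) (Fin.castLE (by omega) y)) c

lemma bidiag_mul_bidiagSol (n m b : ℕ) (X Y : Matrix (Fin n) (Fin n) ℂ) (hY : IsUnit Y.det) :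
    bidiag n m X Y * bidiagSol n m b X Y = borderTop n m b := by
  ext ⟨i, s⟩ c
  rcases c with j | y
  swap
  · simp [Matrix.mul_apply, bidiagSol, borderTop]
  have hYk : ∀ v : Fin n → ℂ, Y.mulVec (Y⁻¹.mulVec v) = v := by
    intro v
    rw [Matrix.mulVec_mulVec, Matrix.mul_nonsing_inv _ hY, Matrix.one_mulVec]
  set t : ℕ → Fin n → ℂ := fun x =>
    if (j : ℕ) ≤ x then Y⁻¹.mulVec (krylov n X Y (x - j)) else 0 with ht
  have hsplit : (bidiag n m X Y * bidiagSol n m b X Y) (i, s) (Sum.inl j)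
      = ∑ x : Fin m, (if x = i then Y.mulVec (t x) s
          else if (x : ℕ) + 1 = i then X.mulVec (t x) s else 0) := by
    rw [Matrix.mul_apply, Fintype.sum_prod_type]
    refine Finset.sum_congr rfl fun x _ => ?_
    have hsol : ∀ u : Fin n, bidiagSol n m b X Y (x, u) (Sum.inl j) = t x u := by
      intro u
      simp only [bidiagSol, Matrix.of_apply, Sum.elim_inl, ht]
      split_ifs <;> rfl
    simp only [hsol]
    by_cases h1 : x = i
    · simp [bidiag, h1, Matrix.mulVec, dotProduct]
    · by_cases h2 : (x : ℕ) + 1 = i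
      · simp [bidiag, h1, h2, Matrix.mulVec, dotProduct]
      · simp [bidiag, h1, h2]
  have hsum : (∑ x : Fin m, (if x = i then Y.mulVec (t x) s
          else if (x : ℕ) + 1 = i then X.mulVec (t x) s else 0))
      = Y.mulVec (t i) s + (if 1 ≤ (i : ℕ) then X.mulVec (t ((i : ℕ) - 1)) s else 0) := by
    have : ∀ x : Fin m, (if x = i then Y.mulVec (t x) s
          else if (x : ℕ) + 1 = i then X.mulVec (t x) s else 0)
        = (if x = i then Y.mulVec (t x) s else 0)
          + (if (x : ℕ) + 1 = i then X.mulVec (t x) s else 0) := by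
      intro x
      by_cases h1 : x = i
      · subst h1
        simp
      · simp [h1]
    simp only [this]
    rw [Finset.sum_add_distrib]
    congr 1
    · simp
    · split_ifs with h
      · rw [Finset.sum_eq_single (⟨(i : ℕ) - 1, by omega⟩ : Fin m)]
        · rw [if_pos]
          simp only
          omega
        · intro x _ hx
          rw [if_neg]
          intro h'
          apply hx
          ext
          simp only
          omega
        · simp
      · refine Finset.sum_eq_zero fun x _ => ?_
        rw [if_neg]
        omega
  rw [hsplit, hsum]
  simp only [borderTop, Matrix.of_apply, Sum.elim_inl, ht]
  rcases lt_trichotomy (j : ℕ) i with h | h | h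
  · obtain ⟨d, hd⟩ := Nat.exists_eq_add_of_lt h
    rw [if_pos (by omega), if_pos (by omega), if_pos (by omega), if_neg (by omega), hYk,
      show (i : ℕ) - j = d + 1 by omega, show (i : ℕ) - 1 - j = d by omega, krylov_succ]
    simp
  · rw [if_pos (by omega), if_pos h, hYk, show (i : ℕ) - j = 0 by omega]
    have : (if 1 ≤ (i : ℕ) then X.mulVec (if (j : ℕ) ≤ (i : ℕ) - 1 then
        Y⁻¹.mulVec (krylov n X Y ((i : ℕ) - 1 - j)) else 0) s else 0) = 0 := by
      split_ifs
      · omega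
      · simp
      · rfl
    rw [this]
    simp [krylov]
  · rw [if_neg (show ¬ (j : ℕ) ≤ i by omega), if_neg (show ¬ (j : ℕ) ≤ i - 1 by omega),
      if_neg (show (j : ℕ) ≠ i by omega)]
    simp

lemma lastCorner_sub (n m b : ℕ) (h : m + 1 + b ≤ n) (hm : 0 < m)
    (X Y : Matrix (Fin n) (Fin n) ℂ) :
    lastCorner n m b h Y - lastRows n m b h X * bidiagSol n m b X Y
      = krylovBlock n m b h X Y := by
  ext r c
  rcases c with j | y
  swap
  · simp [Matrix.mul_apply, bidiagSol, lastCorner, krylovBlock]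
  have hmul : (lastRows n m b h X * bidiagSol n m b X Y) r (Sum.inl j)
      = if (j : ℕ) ≤ m - 1 then
          X.mulVec (Y⁻¹.mulVec (krylov n X Y (m - 1 - j))) (leadIdx n _ b h r) else 0 := by
    rw [Matrix.mul_apply, Fintype.sum_prod_type,
      Finset.sum_eq_single (⟨m - 1, by omega⟩ : Fin m)]
    · have : m - 1 + 1 = m := by omega
      by_cases hj : (j : ℕ) ≤ m - 1
      · simp [lastRows, bidiagSol, this, hj, Matrix.mulVec, dotProduct]
      · simp [lastRows, bidiagSol, this, hj]
    · intro x _ hx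
      have : (x : ℕ) + 1 ≠ m := by
        intro h'
        apply hx
        ext
        simp only
        omega
      simp [lastRows, this]
    · simp
  rw [Matrix.sub_apply, hmul]
  simp only [lastCorner, krylovBlock, Matrix.of_apply, Sum.elim_inl]
  have := j.2
  by_cases hj : (j : ℕ) = m
  · rw [if_pos hj, if_neg (by omega), hj]
    simp [krylov]
  · rw [if_neg hj, if_pos (by omega), show m - (j : ℕ) = (m - 1 - j) + 1 by omega, krylov_succ]
    simp

lemma blockU_mulVec (n k b : ℕ) (h : k + b ≤ n) (X Y : Matrix (Fin n) (Fin n) ℂ)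
    (hX : ∀ i j : Fin n, (k + b ≤ (i : ℕ) ∨ (j : ℕ) < b) → X i j = 0)
    (hY : ∀ i j : Fin n, k + b ≤ (i : ℕ) → (j : ℕ) < b → Y i j = 0)
    (hYinv : IsUnit Y.det) (hY2 : IsUnit (blockY2 n k b h Y).det)
    (v : Fin n → ℂ) (hv : ∀ i : Fin n, k + b ≤ (i : ℕ) → v i = 0)
    (Y₁ : Matrix (Fin k) (Fin b) ℂ)
    (hY₁ : Y₁ = Matrix.of fun i j => Y (Fin.castLE (by omega) i) (Fin.castLE (by omega) j))
    (w : Fin n → ℂ) (hw : w = (X * Y⁻¹).mulVec v) :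
    (fun i => w (leadIdx n k b h (Sum.inl i)))
        - (Y₁ * (blockY2 n k b h Y)⁻¹).mulVec (fun i => w (leadIdx n k b h (Sum.inr i)))
      = (blockU n k b h X Y).mulVec ((fun i => v (leadIdx n k b h (Sum.inl i)))
        - (Y₁ * (blockY2 n k b h Y)⁻¹).mulVec
            (fun i => v (leadIdx n k b h (Sum.inr i)))) := by
  set W := X * Y⁻¹ with hW
  set Y₂ := blockY2 n k b h Y with hY₂
  set e := leadIdx n k b h with he
  have hsum : ∀ f : Fin n → ℂ, (∀ i : Fin n, k + b ≤ (i : ℕ) → f i = 0) →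
      ∑ i, f i = ∑ x : Fin k, f (e (Sum.inl x)) + ∑ y : Fin b, f (e (Sum.inr y)) := by
    intro f hf
    rw [← Fintype.sum_sum_type (fun z => f (e z))]
    have hinj : Function.Injective e := by
      rintro (x | x) (y | y) hxy <;>
        simp [he, leadIdx, Fin.ext_iff] at hxy <;> have hx := x.2 <;> have hy := y.2
      · simp [Fin.ext_iff, hxy]
      · omega
      · omega
      · simp [Fin.ext_iff, hxy]
    rw [← Finset.sum_image (s := Finset.univ) (g := e) (f := f) (hinj.injOn)]
    symm
    apply Finset.sum_subset (Finset.subset_univ _)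
    intro i _ hi
    apply hf
    by_contra hlt
    apply hi
    rw [Finset.mem_image]
    by_cases hik : (i : ℕ) < k
    · exact ⟨Sum.inl ⟨i, hik⟩, Finset.mem_univ _, by simp [he, leadIdx]⟩
    · refine ⟨Sum.inr ⟨i - k, by omega⟩, Finset.mem_univ _, ?_⟩
      simp only [he, leadIdx, Sum.elim_inr, Fin.ext_iff]
      omega
  set W₁₁ : Matrix (Fin k) (Fin k) ℂ := Matrix.of fun i j => W (e (Sum.inl i)) (e (Sum.inl j))
    with h11
  set W₁₂ : Matrix (Fin k) (Fin b) ℂ := Matrix.of fun i j => W (e (Sum.inl i)) (e (Sum.inr j))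
    with h12
  set W₂₁ : Matrix (Fin b) (Fin k) ℂ := Matrix.of fun i j => W (e (Sum.inr i)) (e (Sum.inl j))
    with h21
  set W₂₂ : Matrix (Fin b) (Fin b) ℂ := Matrix.of fun i j => W (e (Sum.inr i)) (e (Sum.inr j))
    with h22
  have hU : blockU n k b h X Y = W₁₁ - Y₁ * Y₂⁻¹ * W₂₁ := by
    rw [hY₁]
    rfl
  have hWY : W * Y = X := by
    rw [hW, Matrix.mul_assoc, Matrix.nonsing_inv_mul _ hYinv, Matrix.mul_one]
  have hzero : ∀ (z : Fin k ⊕ Fin b) (j : Fin b),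
      ∑ x : Fin k, W (e z) (e (Sum.inl x)) * Y₁ x j
        + ∑ y : Fin b, W (e z) (e (Sum.inr y)) * Y₂ y j = 0 := by
    intro z j
    have hj : ((Fin.castLE (by omega) j : Fin n) : ℕ) < b := by simp
    have h0 := hX (e z) (Fin.castLE (by omega) j) (Or.inr hj)
    rw [← hWY, Matrix.mul_apply, hsum _ (fun i hi => by rw [hY i _ hi hj, mul_zero])] at h0
    rw [hY₁]
    exact h0
  have hz1 : W₁₁ * Y₁ + W₁₂ * Y₂ = 0 := by
    ext i j
    simpa [Matrix.mul_apply, h11, h12] using hzero (Sum.inl i) j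
  have hz2 : W₂₁ * Y₁ + W₂₂ * Y₂ = 0 := by
    ext i j
    simpa [Matrix.mul_apply, h21, h22] using hzero (Sum.inr i) j
  have hi12 : W₁₂ = -(W₁₁ * Y₁ * Y₂⁻¹) := by
    rw [← Matrix.mul_nonsing_inv_cancel_right (A := Y₂) W₁₂ hY2, eq_neg_of_add_eq_zero_right hz1,
      Matrix.neg_mul]
  have hi22 : W₂₂ = -(W₂₁ * Y₁ * Y₂⁻¹) := by
    rw [← Matrix.mul_nonsing_inv_cancel_right (A := Y₂) W₂₂ hY2, eq_neg_of_add_eq_zero_right hz2,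
      Matrix.neg_mul]
  set v₁ : Fin k → ℂ := fun i => v (e (Sum.inl i)) with hv1
  set v₂ : Fin b → ℂ := fun i => v (e (Sum.inr i)) with hv2
  have hw1 : (fun i => w (e (Sum.inl i))) = W₁₁.mulVec v₁ + W₁₂.mulVec v₂ := by
    funext i
    simp only [hw, Matrix.mulVec, dotProduct]
    rw [hsum _ (fun i hi => by rw [hv i hi, mul_zero])]
    rfl
  have hw2 : (fun i => w (e (Sum.inr i))) = W₂₁.mulVec v₁ + W₂₂.mulVec v₂ := by
    funext i
    simp only [hw, Matrix.mulVec, dotProduct]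
    rw [hsum _ (fun i hi => by rw [hv i hi, mul_zero])]
    rfl
  rw [hw1, hw2, hU, hi12, hi22]
  simp only [Matrix.mulVec_add, Matrix.mulVec_sub, Matrix.sub_mulVec, Matrix.neg_mulVec,
    Matrix.mulVec_neg, Matrix.mulVec_mulVec, Matrix.mul_assoc, Matrix.sub_mul]
  abel

lemma krylov_schur (n m b : ℕ) (h : m + 1 + b ≤ n) (X Y : Matrix (Fin n) (Fin n) ℂ)
    (hX : ∀ i j : Fin n, (m + 1 + b ≤ (i : ℕ) ∨ (j : ℕ) < b) → X i j = 0)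
    (hY : ∀ i j : Fin n, m + 1 + b ≤ (i : ℕ) → (j : ℕ) < b → Y i j = 0)
    (hYinv : IsUnit Y.det) (hY2 : IsUnit (blockY2 n (m + 1) b h Y).det)
    (Y₁ : Matrix (Fin (m + 1)) (Fin b) ℂ)
    (hY₁ : Y₁ = Matrix.of fun i j => Y (Fin.castLE (by omega) i) (Fin.castLE (by omega) j))
    (j : ℕ) :
    (fun i => krylov n X Y j (leadIdx n _ b h (Sum.inl i)))
        - (Y₁ * (blockY2 n _ b h Y)⁻¹).mulVec
            (fun i => krylov n X Y j (leadIdx n _ b h (Sum.inr i)))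
      = (-1 : ℂ) ^ j • ((blockU n _ b h X Y) ^ j).mulVec (basisVec (m + 1) 0) := by
  have hsupp : ∀ j, ∀ i : Fin n, m + 1 + b ≤ (i : ℕ) → krylov n X Y j i = 0 := by
    intro j i hi
    cases j with
    | zero =>
      have : (i : ℕ) ≠ 0 := by omega
      simp [krylov, basisVec, this]
    | succ j =>
      rw [krylov_succ]
      simp only [Pi.neg_apply, Matrix.mulVec, dotProduct, hX i _ (Or.inl hi), zero_mul,
        Finset.sum_const_zero, neg_zero]
  induction j with
  | zero =>
    have h2 : (fun i => krylov n X Y 0 (leadIdx n (m + 1) b h (Sum.inr i))) = 0 := by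
      funext i
      simp [krylov, basisVec, leadIdx]
    rw [h2, Matrix.mulVec_zero]
    funext i
    simp [krylov, basisVec, leadIdx]
  | succ j ih =>
    have key := blockU_mulVec n (m + 1) b h X Y hX hY hYinv hY2 (krylov n X Y j) (hsupp j) Y₁ hY₁
      (-krylov n X Y (j + 1)) (by rw [krylov_succ, neg_neg, Matrix.mulVec_mulVec])
    rw [ih, Matrix.mulVec_smul, Matrix.mulVec_mulVec, ← pow_succ'] at key
    rw [pow_succ, mul_neg_one, neg_smul, ← key]
    have : ∀ z : Fin (m + 1) ⊕ Fin b, (-krylov n X Y (j + 1)) (leadIdx n _ b h z)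
        = -(krylov n X Y (j + 1) (leadIdx n _ b h z)) := fun z => rfl
    simp only [this]
    funext i
    simp [Matrix.mulVec, dotProduct]
    ring

lemma prod_neg_one_pow_sub (m : ℕ) :
    ∏ j : Fin (m + 1), (-1 : ℂ) ^ (m - (j : ℕ)) = (-1) ^ ((m + 1) * m / 2) := by
  rw [Finset.prod_pow_eq_pow_sum, Fin.sum_univ_eq_sum_range (fun j => m - j) (m + 1)]
  have := Finset.sum_range_reflect (fun j => j) (m + 1)
  simp only [Nat.add_sub_cancel] at this
  rw [this, Finset.sum_range_id, Nat.add_sub_cancel]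

lemma det_krylovBlock (n m b : ℕ) (h : m + 1 + b ≤ n) (X Y : Matrix (Fin n) (Fin n) ℂ)
    (hX : ∀ i j : Fin n, (m + 1 + b ≤ (i : ℕ) ∨ (j : ℕ) < b) → X i j = 0)
    (hY : ∀ i j : Fin n, m + 1 + b ≤ (i : ℕ) → (j : ℕ) < b → Y i j = 0)
    (hYinv : IsUnit Y.det) (hY2 : IsUnit (blockY2 n (m + 1) b h Y).det) :
    (krylovBlock n m b h X Y).det = (blockY2 n (m + 1) b h Y).det *
      ((-1) ^ ((m + 1) * m / 2) * (Matrix.of fun i j : Fin (m + 1) =>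
        ((blockU n _ b h X Y) ^ (m - (j : ℕ))).mulVec (basisVec (m + 1) 0) i).det) := by
  set Y₁ : Matrix (Fin (m + 1)) (Fin b) ℂ :=
    Matrix.of fun i j => Y (Fin.castLE (by omega) i) (Fin.castLE (by omega) j) with hY₁
  have hblock : krylovBlock n m b h X Y = Matrix.fromBlocks
      (Matrix.of fun i j : Fin (m + 1) => krylov n X Y (m - j) (leadIdx n _ b h (Sum.inl i)))
      Y₁
      (Matrix.of fun (i : Fin b) (j : Fin (m + 1)) =>
        krylov n X Y (m - j) (leadIdx n _ b h (Sum.inr i)))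
      (blockY2 n _ b h Y) := by
    ext (i | i) (j | j) <;> rfl
  have : Invertible (blockY2 n (m + 1) b h Y) := Matrix.invertibleOfIsUnitDet _ hY2
  rw [hblock, Matrix.det_fromBlocks₂₂, Matrix.invOf_eq_nonsing_inv]
  congr 1
  rw [← prod_neg_one_pow_sub, ← Matrix.det_mul_row]
  congr 1
  ext i j
  have := congrFun (krylov_schur n m b h X Y hX hY hYinv hY2 Y₁ hY₁ (m - j)) i
  simpa [Matrix.mul_apply, Matrix.mulVec, dotProduct] using this

/-- The identification of the rows and columns of the bordered core with their block indices. -/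
def blockEquiv (n m b : ℕ) :
    (Fin m × Fin n) ⊕ (Fin (m + 1) ⊕ Fin b) ≃ Fin (m * n + b + (m + 1)) :=
  ((Equiv.sumCongr finProdFinEquiv finSumFinEquiv).trans finSumFinEquiv).trans
    (finCongr (by omega))

lemma borderedCore_submatrix (n m b : ℕ) (h : m + 1 + b ≤ n) (X Y : ℕ → ℕ → ℂ) :
    (Matrix.of fun r c : Fin (m * n + b + (m + 1)) => borderedCore n m X Y r c).submatrix
        (blockEquiv n m b) (blockEquiv n m b)
      = Matrix.fromBlocks (bidiag n m (toSq n X) (toSq n Y)) (borderTop n m b)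
          (lastRows n m b h (toSq n X)) (lastCorner n m b h (toSq n Y)) := by
  have hn : 0 < n := by omega
  have e1 : ∀ (i : Fin m) (s : Fin n),
      (blockEquiv n m b (Sum.inl (i, s)) : ℕ) = s + n * i := fun i s => by
    simp [blockEquiv]
  have e2 : ∀ z : Fin (m + 1) ⊕ Fin b,
      (blockEquiv n m b (Sum.inr z) : ℕ) = m * n + leadIdx n _ b h z := by
    rintro (x | y) <;> simp [blockEquiv, leadIdx]
  have hlt : ∀ (i : Fin m) (s : Fin n), (s : ℕ) + n * i < m * n := by
    intro i s
    have := Nat.mul_le_mul_left n (Nat.succ_le_of_lt i.2)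
    rw [Nat.mul_succ] at this
    have := s.2
    rw [mul_comm m n]
    omega
  have hdiv : ∀ (i : Fin m) (s : Fin n), ((s : ℕ) + n * i) / n = i := by
    intro i s
    rw [Nat.add_mul_div_left _ _ hn, Nat.div_eq_of_lt s.2, zero_add]
  have hmod : ∀ (i : Fin m) (s : Fin n), ((s : ℕ) + n * i) % n = s := by
    intro i s
    rw [Nat.add_mul_mod_self_left, Nat.mod_eq_of_lt s.2]
  have hdiv' : ∀ s : Fin n, (m * n + (s : ℕ)) / n = m := by
    intro s
    rw [add_comm, Nat.add_mul_div_right _ _ hn, Nat.div_eq_of_lt s.2, zero_add]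
  have hmod' : ∀ s : Fin n, (m * n + (s : ℕ)) % n = s := by
    intro s
    rw [add_comm, Nat.add_mul_mod_self_right, Nat.mod_eq_of_lt s.2]
  have hfirst : ∀ (x y : ℕ) (s : Fin n), (s : ℕ) + n * x = y * n ↔ y = x ∧ (s : ℕ) = 0 := by
    intro x y s
    constructor
    · intro heq
      have h1 : ((s : ℕ) + n * x) / n = x := by
        rw [Nat.add_mul_div_left _ _ hn, Nat.div_eq_of_lt s.2, zero_add]
      rw [heq, Nat.mul_div_cancel _ hn] at h1
      subst h1
      rw [mul_comm] at heq
      exact ⟨rfl, by omega⟩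
    · rintro ⟨rfl, hs⟩
      rw [hs, mul_comm, zero_add]
  have hl1 : ∀ x : Fin (m + 1), ((leadIdx n (m + 1) b h (Sum.inl x) : Fin n) : ℕ) = x :=
    fun x => rfl
  have hl2 : ∀ y : Fin b, ((leadIdx n (m + 1) b h (Sum.inr y) : Fin n) : ℕ) = m + 1 + y :=
    fun y => rfl
  ext r c
  simp only [Matrix.submatrix_apply, Matrix.of_apply]
  rcases r with ⟨i, s⟩ | z <;> rcases c with ⟨j, t⟩ | x | y
  · rw [e1, e1]
    simp [borderedCore, bidiag, toSq, hlt, hdiv, hmod, Fin.ext_iff]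
  · have hx := x.2
    rw [e1, e2, hl1]
    simp only [borderedCore, borderTop, Matrix.fromBlocks_apply₁₂, Matrix.of_apply, Sum.elim_inl,
      basisVec]
    rw [if_neg (by omega), if_pos (by omega), Nat.add_sub_cancel_left]
    simp only [hfirst]
    by_cases h1 : (x : ℕ) = i <;> by_cases h2 : (s : ℕ) = 0 <;> simp [h1, h2]
  · have := hlt i s
    rw [e1, e2, hl2]
    simp only [borderedCore, borderTop, Matrix.fromBlocks_apply₁₂, Matrix.of_apply, Sum.elim_inr]
    rw [if_neg (by omega), if_neg (by omega), if_neg (by omega)]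
  · have := j.2
    rw [e1, e2]
    simp only [borderedCore, lastRows, Matrix.fromBlocks_apply₂₁, Matrix.of_apply, toSq]
    rw [if_pos (hlt j t), hdiv, hdiv', hmod, hmod', if_neg (by omega)]
  · have hx := x.2
    rw [e2, e2, hl1]
    simp only [borderedCore, lastCorner, Matrix.fromBlocks_apply₂₂, Matrix.of_apply, Sum.elim_inl,
      basisVec]
    rw [if_neg (by omega), if_pos (by omega), Nat.add_sub_cancel_left, add_comm, mul_comm m n]
    simp only [hfirst]
    by_cases h1 : (x : ℕ) = m <;>
      by_cases h2 : ((leadIdx n (m + 1) b h z : Fin n) : ℕ) = 0 <;> simp [h1, h2]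
  · rw [e2, e2, hl2]
    simp only [borderedCore, lastCorner, Matrix.fromBlocks_apply₂₂, Matrix.of_apply, Sum.elim_inr,
      toSq]
    rw [if_neg (by omega), if_neg (by omega), if_pos (by omega), Nat.add_sub_cancel_left]
    congr 1
    simp only [Fin.val_castLE]
    omega

lemma prod_neg_one_pow_expansion (q m : ℕ) :
    ∏ i ∈ Finset.range (m + 1), (-1 : ℂ) ^ (i * q + m * (q + 1))
      = (-1) ^ (q * ((m + 1) * m / 2)) := by
  rw [Finset.prod_pow_eq_pow_sum, Finset.sum_add_distrib, ← Finset.sum_mul, Finset.sum_range_id,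
    Nat.add_sub_cancel, Finset.sum_const, Finset.card_range, pow_add, mul_comm q]
  have : Even ((m + 1) • (m * (q + 1))) := by
    rw [smul_eq_mul, ← mul_assoc, mul_comm (m + 1) m]
    exact (Nat.even_mul_succ_self m).mul_right _
  rw [this.neg_one_pow, mul_one]

/-- the core determinant via `U`:
`φ_1 = ε_1 (det Y)^(k-1) det Y2 · det[U^{k-1}e_1, …, U e_1, e_1]`. -/
theorem statement6 (n k b : ℕ) (hk : 2 ≤ k) (hn : k + b ≤ n)
    (X Y : ℕ → ℕ → ℂ)
    (hX : ∀ i j : ℕ, (k + b ≤ i ∨ j < b) → X i j = 0)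
    (hY : ∀ i j : ℕ, k + b ≤ i → j < b → Y i j = 0)
    (hYinv : IsUnit (toSq n Y).det)
    (hY2inv : IsUnit (blockY2 n k b hn (toSq n Y)).det) :
    sminor (stairCore n k X Y) 1 ((k - 1) * n + b)
      = (-1 : ℂ) ^ (n * (k * (k - 1) / 2)) * (toSq n Y).det ^ (k - 1)
        * (blockY2 n k b hn (toSq n Y)).det
        * (Matrix.of fun i j : Fin k =>
            ((blockU n k b hn (toSq n X) (toSq n Y)) ^ (k - 1 - (j : ℕ))).mulVec
              (basisVec k 0) i).det := by
  obtain ⟨m, rfl⟩ : ∃ m, k = m + 1 := ⟨k - 1, by omega⟩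
  obtain ⟨q, rfl⟩ : ∃ q, n = q + 1 := ⟨n - 1, by omega⟩
  have hm : 0 < m := by omega
  have hq : 0 < q := by omega
  have hX' : ∀ i j : Fin (q + 1), (m + 1 + b ≤ (i : ℕ) ∨ (j : ℕ) < b) →
      toSq (q + 1) X i j = 0 := fun i j => hX i j
  have hY' : ∀ i j : Fin (q + 1), m + 1 + b ≤ (i : ℕ) → (j : ℕ) < b →
      toSq (q + 1) Y i j = 0 := fun i j => hY i j
  have hbig : (Matrix.of fun r c : Fin (m * (q + 1) + b + (m + 1)) =>
      borderedCore (q + 1) m X Y r c).det = (toSq (q + 1) Y).det ^ m *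
        (krylovBlock (q + 1) m b hn (toSq (q + 1) X) (toSq (q + 1) Y)).det := by
    rw [← Matrix.det_submatrix_equiv_self (blockEquiv (q + 1) m b),
      borderedCore_submatrix (q + 1) m b hn X Y,
      det_fromBlocks_of_mul_eq _ _ _ _ _ (bidiag_mul_bidiagSol (q + 1) m b _ _ hYinv),
      lastCorner_sub _ _ _ _ hm, det_bidiag]
  have hexp := det_borderedCore_eq_prod_mul_det_skip q m b hq X Y (m + 1) 0 rfl
  rw [hbig, prod_neg_one_pow_expansion,
    det_krylovBlock _ _ _ _ _ _ hX' hY' hYinv hY2inv] at hexp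
  have hcore : sminor (stairCore (q + 1) (m + 1) X Y) 1 ((m + 1 - 1) * (q + 1) + b)
      = (Matrix.of fun r c : Fin (m * (q + 1) + b + 0) =>
          borderedCore (q + 1) m X Y (skipRows q (m + 1) r)
            (skipCols (m * (q + 1)) (m + 1) c)).det := by
    unfold sminor
    congr 1
    ext r c
    have key := stairCore_eq_borderedCore q m b hq hm hn X Y r c r.2 c.2
    simpa using key
  rw [hcore]
  simp only [Nat.add_sub_cancel]
  have hsq : ((-1 : ℂ) ^ (q * ((m + 1) * m / 2))) * (-1) ^ (q * ((m + 1) * m / 2)) = 1 := by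
    rw [← mul_pow]
    simp
  rw [add_mul, one_mul, pow_add]
  generalize (-1 : ℂ) ^ (q * ((m + 1) * m / 2)) = ε at *
  generalize (-1 : ℂ) ^ ((m + 1) * m / 2) = δ at *
  calc _ = ε * ε * _ := by rw [hsq, one_mul]
    _ = ε * (ε * _) := mul_assoc _ _ _
    _ = _ := by
      rw [← hexp]
      ring

end
end

section
/- Under the staircase hypotheses, assume Y is invertible, Y2 is invertible and det Ȳ ≠ 0. Set γ = (det of the minor of Y on rows {1,3,4,…,n} and columns {2,…,n}) / det Ȳ, and v_γ = U(e_2 + γe_1). Then φ_2 = ε_2 · (det Y)^{k−2} · det Ȳ · det Y_2 · det[U^{k−2}v_γ, U^{k−2}e_1, U^{k−3}e_1, …, U e_1, e_1], where ε_2 = −(−1)^{n·k(k−1)/2} and the displayed k×k matrix has the indicated columns. -/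
open Matrix Finset

noncomputable section

/-- The determinant of the leading `M × M` block of an `ℕ`-indexed matrix. -/
def natDet (M : ℕ) (f : ℕ → ℕ → ℂ) : ℂ :=
  (Matrix.of fun i j : Fin M => f (i : ℕ) (j : ℕ)).det

theorem natDet_congr {M : ℕ} {f g : ℕ → ℕ → ℂ}
    (h : ∀ i j, i < M → j < M → f i j = g i j) : natDet M f = natDet M g := by
  unfold natDet
  congr 1
  ext i j
  exact h i j i.isLt j.isLt

theorem natDet_rotate_one (m : ℕ) (f : ℕ → ℕ → ℂ) :
    natDet (m + 1) f = (-1) ^ m * natDet (m + 1) (fun i j => f i ((j + 1) % (m + 1))) := by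
  have h := Matrix.det_permute' (finRotate (m + 1))
    (Matrix.of fun i j : Fin (m + 1) => f (i : ℕ) (j : ℕ))
  rw [sign_finRotate] at h
  have h2 : ((Matrix.of fun i j : Fin (m + 1) => f (i : ℕ) (j : ℕ)).submatrix id
      (finRotate (m + 1))) = Matrix.of fun i j : Fin (m + 1) =>
        f (i : ℕ) (((j : ℕ) + 1) % (m + 1)) := by
    ext i j
    simp [Fin.val_add]
  rw [h2] at h
  unfold natDet
  rw [h, ← mul_assoc]
  push_cast
  rw [← mul_pow]
  simp

/-- Cyclically shifting the columns of a matrix by `q` multiplies its determinant by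
`(-1) ^ ((M - 1) * q)`. -/
theorem natDet_rotate (M q : ℕ) (f : ℕ → ℕ → ℂ) :
    natDet M f = (-1) ^ ((M - 1) * q) * natDet M (fun i j => f i ((j + q) % M)) := by
  rcases M with _ | m
  · simp [natDet]
  induction q with
  | zero =>
    simp only [mul_zero, pow_zero, one_mul]
    exact natDet_congr fun i j _ hj => by rw [add_zero, Nat.mod_eq_of_lt hj]
  | succ q ih =>
    rw [ih, natDet_rotate_one m, ← mul_assoc, Nat.add_sub_cancel, ← pow_add]
    congr 2
    funext i j
    congr 1
    rw [Nat.mod_add_mod]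
    congr 1
    ring

theorem natDet_neg_columns (r q : ℕ) (hq : q ≤ r) (g : ℕ → ℕ → ℂ) :
    natDet r (fun i j => (if j < q then -1 else 1) * g i j) = (-1) ^ q * natDet r g := by
  unfold natDet
  have h := Matrix.det_mul_row (fun j : Fin r => if (j : ℕ) < q then (-1 : ℂ) else 1)
    (Matrix.of fun i j : Fin r => g (i : ℕ) (j : ℕ))
  have h2 : ∏ j : Fin r, (if (j : ℕ) < q then (-1 : ℂ) else 1) = (-1) ^ q := by
    rw [Fin.prod_univ_eq_prod_range (fun j => if j < q then (-1 : ℂ) else 1) r]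
    rw [Finset.prod_ite]
    simp only [prod_const, one_pow, mul_one]
    congr 1
    have : (Finset.range r).filter (fun j => j < q) = Finset.range q := by
      ext j; simp; omega
    rw [this, Finset.card_range]
  rw [h2] at h
  rw [← h]
  rfl

theorem natDet_fromBlocks (p r : ℕ) (f : ℕ → ℕ → ℂ) :
    natDet (p + r) f = (Matrix.fromBlocks
      (Matrix.of fun i j : Fin p => f i j)
      (Matrix.of fun (i : Fin p) (j : Fin r) => f i (p + j))
      (Matrix.of fun (i : Fin r) (j : Fin p) => f (p + i) j)
      (Matrix.of fun i j : Fin r => f (p + i) (p + j))).det := by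
  unfold natDet
  rw [← Matrix.det_submatrix_equiv_self finSumFinEquiv]
  congr 1
  ext i j
  rcases i with i | i <;> rcases j with j | j <;> simp

/-- Block elimination for a matrix of the shape `[B A 0; 0 C D]` with `A` invertible. -/
theorem natDet_eliminate (p q r : ℕ) (hq : q ≤ r) (f g : ℕ → ℕ → ℂ)
    (A : Matrix (Fin p) (Fin p) ℂ) (hA : IsUnit A.det)
    (hfA : ∀ i j : Fin p, f i (q + j) = A i j)
    (hfz : ∀ i j, i < p → q + p ≤ j → j < p + r → f i j = 0)
    (hfl : ∀ i j, i < r → j < q → f (p + i) j = 0)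
    (Z : ℕ → Fin p → ℂ)
    (hZ : ∀ j, j < q → ∀ i : Fin p, (A *ᵥ Z j) i = f i j)
    (hg : ∀ i j, i < r → j < q → g i j = ∑ s : Fin p, f (p + i) (q + s) * Z j s)
    (hgr : ∀ i j, i < r → q ≤ j → j < r → g i j = f (p + i) (p + j)) :
    natDet (p + r) f = (-1) ^ ((p + 1) * q) * A.det * natDet r g := by
  have hinv : Invertible A := Matrix.invertibleOfIsUnitDet A hA
  have key : natDet (p + r) (fun i j => f i ((j + q) % (p + r)))
      = A.det * natDet r (fun i j =>
        (fun i j => (if j < q then -1 else 1) * g i j) i ((j + q) % r)) := by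
    rw [natDet_fromBlocks]
    have e1 : (Matrix.of fun i j : Fin p => f i (((j : ℕ) + q) % (p + r))) = A := by
      ext i j
      simp only [Matrix.of_apply]
      rw [Nat.mod_eq_of_lt (by omega), add_comm]
      exact hfA i j
    rw [e1, Matrix.det_fromBlocks₁₁]
    unfold natDet
    congr 2
    ext i j
    have hi := i.isLt
    have hj := j.isLt
    simp only [Matrix.sub_apply, Matrix.of_apply]
    by_cases hjr : (j : ℕ) + q < r
    · rw [Nat.mod_eq_of_lt (show p + (j : ℕ) + q < p + r by omega), Nat.mod_eq_of_lt hjr,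
        if_neg (by omega), one_mul, hgr _ _ hi (by omega) hjr, add_assoc]
      rw [sub_eq_self, Matrix.mul_apply]
      refine Finset.sum_eq_zero fun s _ => ?_
      simp only [Matrix.of_apply]
      rw [Nat.mod_eq_of_lt (by omega), hfz _ _ s.isLt (by omega) (by omega), mul_zero]
    · have m1 : (p + (j : ℕ) + q) % (p + r) = j + q - r := by
        rw [Nat.mod_eq_sub_mod (by omega), Nat.mod_eq_of_lt (by omega)]; omega
      have m2 : ((j : ℕ) + q) % r = j + q - r := by
        rw [Nat.mod_eq_sub_mod (by omega), Nat.mod_eq_of_lt (by omega)]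
      rw [m1, m2, if_pos (by omega), hfl _ _ hi (by omega), zero_sub, neg_one_mul,
        hg _ _ hi (by omega), Matrix.mul_assoc, Matrix.mul_apply]
      congr 1
      refine Finset.sum_congr rfl fun s _ => ?_
      simp only [Matrix.of_apply]
      rw [Nat.mod_eq_of_lt (show (s : ℕ) + q < p + r by omega), add_comm (s : ℕ) q]
      congr 1
      have hcol : (fun t : Fin p => f t (j + q - r)) = A *ᵥ Z (j + q - r) := by
        funext t
        exact (hZ _ (by omega) t).symm
      have hmul : (⅟A *ᵥ (fun t : Fin p => f t (j + q - r))) s = Z (j + q - r) s := by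
        rw [hcol, Matrix.mulVec_mulVec, invOf_mul_self, Matrix.one_mulVec]
      rw [← hmul, Matrix.mul_apply]
      simp only [Matrix.mulVec, dotProduct, Matrix.of_apply, m1]
  have hrot := natDet_rotate r q (fun i j => (if j < q then -1 else 1) * g i j)
  rw [natDet_neg_columns r q hq] at hrot
  rw [natDet_rotate (p + r) q f, key]
  set G := natDet r (fun i j =>
        (fun i j => (if j < q then -1 else 1) * g i j) i ((j + q) % r)) with hG
  have hsq : ∀ t : ℕ, ((-1 : ℂ) ^ t) * (-1) ^ t = 1 := fun t => by
    rw [← mul_pow]; simp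
  have hG2 : G = (-1) ^ ((r - 1) * q) * (-1) ^ q * natDet r g := by
    rw [mul_assoc, hrot, ← mul_assoc, hsq, one_mul]
  rw [hG2]
  have hs : (-1 : ℂ) ^ ((p + r - 1) * q) * ((-1) ^ ((r - 1) * q) * (-1) ^ q)
      = (-1) ^ ((p + 1) * q) := by
    rcases r with _ | s
    · obtain rfl : q = 0 := by omega
      simp
    · simp only [Nat.add_sub_cancel, ← add_assoc]
      have : (p + s) * q + (s * q + q) = (p + 1) * q + (s * q + s * q) := by ring
      rw [← pow_add, ← pow_add, this, pow_add, pow_add (-1 : ℂ) (s * q), hsq, mul_one]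
  rw [← hs]
  ring

/-- Bordering a matrix by a first row and by a column equal to the first unit vector. -/
theorem natDet_border (M q : ℕ) (hq : q ≤ M) (f f' : ℕ → ℕ → ℂ)
    (h0 : f' 0 q = 1) (h1 : ∀ i, i < M → f' (i + 1) q = 0)
    (hl : ∀ i j, i < M → j < q → f' (i + 1) j = f i j)
    (hr : ∀ i j, i < M → q ≤ j → j < M → f' (i + 1) (j + 1) = f i j) :
    natDet M f = (-1) ^ q * natDet (M + 1) f' := by
  have h : natDet (M + 1) f' = (-1) ^ q * natDet M f := by
    unfold natDet
    rw [Matrix.det_succ_column _ (⟨q, by omega⟩ : Fin (M + 1)), Fin.sum_univ_succ,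
      Finset.sum_eq_zero, add_zero]
    · simp only [Matrix.of_apply, Fin.val_zero, zero_add, h0, mul_one]
      congr 2
      ext i j
      simp only [Matrix.submatrix_apply, Matrix.of_apply, Fin.zero_succAbove, Fin.val_succ]
      by_cases hj : (j : ℕ) < q
      · rw [Fin.succAbove_of_castSucc_lt _ _ (by simpa [Fin.lt_def] using hj)]
        exact hl _ _ i.isLt hj
      · rw [Fin.succAbove_of_le_castSucc _ _ (by simpa [Fin.le_def] using hj)]
        exact hr _ _ i.isLt (by omega) j.isLt
    · intro i _
      simp [h1 i i.isLt]
  rw [h, ← mul_assoc, ← mul_pow]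
  simp

theorem stairCore_diag {n k q i j : ℕ} (X Y : ℕ → ℕ → ℂ) (hq : q < k - 1) (hi : i < n - 1)
    (hj : j < n) : stairCore n k X Y (i + q * (n - 1)) (j + q * n) = Y (i + 1) j := by
  have hlt : i + q * (n - 1) < (k - 1) * (n - 1) := by
    have := Nat.mul_le_mul_right (n - 1) (show q + 1 ≤ k - 1 from hq)
    rw [add_mul, one_mul] at this
    omega
  have hd : (i + q * (n - 1)) / (n - 1) = q := by
    rw [Nat.add_mul_div_right _ _ (by omega), Nat.div_eq_of_lt hi, zero_add]
  have hm : (i + q * (n - 1)) % (n - 1) = i := by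
    rw [Nat.add_mul_mod_self_right, Nat.mod_eq_of_lt hi]
  unfold stairCore
  rw [if_pos hlt, hd, hm, if_pos ⟨by omega, by omega⟩, Nat.add_sub_cancel]

theorem stairCore_right {n k q i j : ℕ} (X Y : ℕ → ℕ → ℂ) (hq : q < k - 1) (hi : i < n - 1)
    (hj : n ≤ j) : stairCore n k X Y (i + q * (n - 1)) (j + q * n) = 0 := by
  have hlt : i + q * (n - 1) < (k - 1) * (n - 1) := by
    have := Nat.mul_le_mul_right (n - 1) (show q + 1 ≤ k - 1 from hq)
    rw [add_mul, one_mul] at this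
    omega
  have hd : (i + q * (n - 1)) / (n - 1) = q := by
    rw [Nat.add_mul_div_right _ _ (by omega), Nat.div_eq_of_lt hi, zero_add]
  unfold stairCore
  rw [if_pos hlt, hd, if_neg (by omega), if_neg (by omega)]

theorem stairCore_below {n k q i j : ℕ} (X Y : ℕ → ℕ → ℂ) (hX : ∀ i j, n ≤ i → X i j = 0)
    (hn : 2 ≤ n) (hq : q < k - 1) (hj : j < n) :
    stairCore n k X Y (i + (q + 1) * (n - 1)) (j + q * n)
      = if i < n - 1 then X (i + 1) j else 0 := by
  have hqn : (q + 1) * n = q * n + n := by ring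
  unfold stairCore
  by_cases hlt : i + (q + 1) * (n - 1) < (k - 1) * (n - 1)
  · have hd : (i + (q + 1) * (n - 1)) / (n - 1) = q + 1 + i / (n - 1) := by
      rw [Nat.add_mul_div_right _ _ (by omega), add_comm]
    have hm : (i + (q + 1) * (n - 1)) % (n - 1) = i % (n - 1) := by
      rw [Nat.add_mul_mod_self_right]
    rw [if_pos hlt, hd, hm]
    by_cases hi : i < n - 1
    · rw [Nat.div_eq_of_lt hi, Nat.mod_eq_of_lt hi, add_zero, Nat.add_sub_cancel, hqn,
        if_neg (by omega), if_pos ⟨by omega, by omega, by omega⟩, if_pos hi, Nat.add_sub_cancel]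
    · have h1 : 1 ≤ i / (n - 1) := (Nat.one_le_div_iff (by omega)).2 (by omega)
      have h2 := Nat.mul_le_mul_right n (show q + 1 ≤ q + 1 + i / (n - 1) by omega)
      have h3 := Nat.mul_le_mul_right n (show q + 1 ≤ q + 1 + i / (n - 1) - 1 by omega)
      rw [if_neg (by omega), if_neg (by omega), if_neg hi]
  · rw [if_neg hlt]
    by_cases hk : k = q + 2
    · subst hk
      rw [show q + 2 - 1 = q + 1 from rfl, show q + 2 - 2 = q from rfl,
        if_pos ⟨by omega, by omega⟩, Nat.add_sub_cancel, Nat.add_sub_cancel]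
      split_ifs with hi
      · rfl
      · exact hX _ _ (by omega)
    · have h1 := Nat.mul_le_mul_right n (show q + 1 ≤ k - 2 by omega)
      have h2 := Nat.mul_le_mul_right n (show q + 1 ≤ k - 1 by omega)
      have h3 := Nat.mul_le_mul_right (n - 1) (show q + 2 ≤ k - 1 by omega)
      have h4 : (q + 2) * (n - 1) = (q + 1) * (n - 1) + (n - 1) := by ring
      rw [if_neg (by omega), if_neg (by omega), if_neg (by omega)]

theorem stairCore_last {n k i j : ℕ} (X Y : ℕ → ℕ → ℂ) :
    stairCore n k X Y (i + (k - 1) * (n - 1)) (j + (k - 1) * n) = Y (i + 1) j := by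
  unfold stairCore
  rw [if_neg (by omega), if_neg (by omega), if_pos (by omega), Nat.add_sub_cancel,
    Nat.add_sub_cancel]

/-- The core with its first `q` block rows and block columns removed, bordered on the left by
the lower `n - 1` entries of the vectors `V 0, …, V (q - 1)`. -/
def reducedCore (n k : ℕ) (X Y : ℕ → ℕ → ℂ) (V : ℕ → Fin n → ℂ) (q : ℕ) : ℕ → ℕ → ℂ := fun i j =>
  if j < q then (if h : i + 1 < n then V j ⟨i + 1, h⟩ else 0)
  else stairCore n k X Y (i + q * (n - 1)) (j - q + q * n)

theorem natDet_reducedCore_step {n k b q m : ℕ} (X Y : ℕ → ℕ → ℂ)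
    (hX : ∀ i j, n ≤ i → X i j = 0) (hn : 2 ≤ n) (hkm : k = q + m + 2)
    (hYinv : IsUnit (toSq n Y).det) (V V' : ℕ → Fin n → ℂ)
    (hV : ∀ j, j < q → V' j = (toSq n X * (toSq n Y)⁻¹) *ᵥ V j)
    (hVq : V' q = (toSq n X * (toSq n Y)⁻¹) *ᵥ Pi.single ⟨0, by omega⟩ 1) :
    natDet ((m + 1) * n + b + q) (reducedCore n k X Y V q)
      = (-1) ^ q * ((-1) ^ ((n + 1) * (q + 1)) * (toSq n Y).det
        * natDet (m * n + b + q + 1) (reducedCore n k X Y V' (q + 1))) := by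
  have hmn : (m + 1) * n = m * n + n := by ring
  have hqn : (q + 1) * n = q * n + n := by ring
  have hqn1 : (q + 1) * (n - 1) = q * (n - 1) + (n - 1) := by ring
  set u : ℕ → Fin n → ℂ := fun j => if j < q then V j else Pi.single ⟨0, by omega⟩ 1 with hu
  set f' : ℕ → ℕ → ℂ := fun i j =>
    if j < q + 1 then (if h : i < n then u j ⟨i, h⟩ else 0)
    else if i = 0 then (if j - (q + 1) < n then Y 0 (j - (q + 1)) else 0)
    else stairCore n k X Y (i - 1 + q * (n - 1)) (j - (q + 1) + q * n) with hf'
  rw [natDet_border _ q (by omega) _ f']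
  · rw [show (m + 1) * n + b + q + 1 = n + (m * n + b + q + 1) by omega,
      natDet_eliminate n (q + 1) (m * n + b + q + 1) (by omega) f'
        (reducedCore n k X Y V' (q + 1)) (toSq n Y) hYinv ?_ ?_ ?_
        (fun j => (toSq n Y)⁻¹ *ᵥ u j) ?_ ?_ ?_]
    · intro i j
      have hi := i.isLt
      have hj := j.isLt
      simp only [hf', toSq, Matrix.of_apply, Nat.add_sub_cancel_left]
      rw [if_neg (by omega), if_pos hj]
      split_ifs with h0
      · rw [h0]
      · rw [stairCore_diag X Y (by omega) (by omega) hj, Nat.sub_add_cancel (by omega)]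
    · intro i j hi hj hj2
      simp only [hf']
      rw [if_neg (by omega)]
      split_ifs with h0 h1
      · omega
      · rfl
      · exact stairCore_right X Y (by omega) (by omega) (by omega)
    · intro i j hi hj
      simp only [hf']
      rw [if_pos hj, dif_neg (by omega)]
    · intro j hj i
      rw [Matrix.mulVec_mulVec, Matrix.mul_nonsing_inv _ hYinv, Matrix.one_mulVec]
      simp only [hf']
      rw [if_pos hj, dif_pos i.isLt]
    · intro i j hi hj
      have hV' : V' j = toSq n X *ᵥ ((toSq n Y)⁻¹ *ᵥ u j) := by
        rw [Matrix.mulVec_mulVec]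
        rcases Nat.lt_succ_iff_lt_or_eq.1 hj with h | h
        · rw [hV j h, hu]; simp only [if_pos h]
        · rw [h, hVq, hu]; simp only [lt_irrefl, if_false]
      have hf2 : ∀ s : Fin n, f' (n + i) (q + 1 + s)
          = if i < n - 1 then X (i + 1) s else 0 := by
        intro s
        simp only [hf', Nat.add_sub_cancel_left]
        rw [if_neg (by omega), if_neg (by omega), ← stairCore_below X Y hX hn
          (show q < k - 1 by omega) s.isLt]
        congr 1
        omega
      simp only [hf2]
      unfold reducedCore
      rw [if_pos hj]
      by_cases hi2 : i + 1 < n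
      · rw [dif_pos hi2, hV']
        simp only [if_pos (show i < n - 1 by omega)]
        rfl
      · rw [dif_neg hi2]
        simp only [if_neg (show ¬ i < n - 1 by omega), zero_mul, Finset.sum_const_zero]
    · intro i j hi hj hj2
      simp only [hf', reducedCore]
      rw [if_neg (by omega), if_neg (by omega), if_neg (by omega)]
      congr 1 <;> omega
  · simp [hf', hu, show 0 < n by omega]
  · intro i hi
    simp only [hf', hu, lt_irrefl, if_false, if_pos (Nat.lt_succ_self q)]
    split_ifs with h
    · rw [Pi.single_eq_of_ne]
      simp [Fin.ext_iff]
    · rfl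
  · intro i j hi hj
    simp only [hf', hu, reducedCore, if_pos hj, if_pos (show j < q + 1 by omega)]
  · intro i j hi hj hj2
    simp only [hf', reducedCore]
    rw [if_neg (by omega), if_neg (by omega), if_neg (by omega)]
    congr 1
    omega

theorem sum_cons_zero (n : ℕ) (hn : 1 ≤ n) (y : ℕ → ℂ) (c : Fin (n - 1) → ℂ) :
    ∑ s : Fin n, y s * (if _h : (s : ℕ) = 0 then 0 else c ⟨s - 1, by omega⟩)
      = ∑ s : Fin (n - 1), y (s + 1) * c s := by
  obtain ⟨m, rfl⟩ := Nat.exists_eq_add_of_le' hn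
  rw [Fin.sum_univ_succ]
  simp

/-- The vector `e_2 + γ e_1` in `ℂ^n`. -/
def gammaVec (n : ℕ) (Y : ℕ → ℕ → ℂ) : Fin n → ℂ := fun i =>
  (if (i : ℕ) = 1 then 1 else 0) + detYgamma n Y / detYbar n Y * (if (i : ℕ) = 0 then 1 else 0)

/-- Solving `Ȳ c = e_1`, the vector `(0, c)` is the preimage of `e_2 + γ e_1` under `Y`. -/
theorem exists_preimage_gammaVec (n : ℕ) (hn : 2 ≤ n) (Y : ℕ → ℕ → ℂ)
    (hYbar : detYbar n Y ≠ 0) : ∃ c : Fin (n - 1) → ℂ,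
    (∀ i : Fin (n - 1), ∑ s : Fin (n - 1), Y (i + 1) (s + 1) * c s = if (i : ℕ) = 0 then 1 else 0)
    ∧ toSq n Y *ᵥ (fun s : Fin n => if _h : (s : ℕ) = 0 then 0 else c ⟨s - 1, by omega⟩)
      = gammaVec n Y := by
  set A : Matrix (Fin (n - 1)) (Fin (n - 1)) ℂ :=
    Matrix.of fun i j => Y ((i : ℕ) + 1) ((j : ℕ) + 1) with hA
  have hdet : A.det = detYbar n Y := rfl
  set z : Fin (n - 1) := ⟨0, by omega⟩ with hz
  have hc : ∀ i : Fin (n - 1), ∑ s : Fin (n - 1), Y (i + 1) (s + 1) * A⁻¹ s z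
      = if (i : ℕ) = 0 then 1 else 0 := by
    intro i
    have h : (A * A⁻¹) i z = (1 : Matrix _ _ ℂ) i z := by
      rw [Matrix.mul_nonsing_inv _ (by rw [hdet]; exact isUnit_iff_ne_zero.2 hYbar)]
    rw [Matrix.one_apply, Matrix.mul_apply] at h
    simpa [hA, Fin.ext_iff, hz] using h
  refine ⟨fun s => A⁻¹ s z, hc, ?_⟩
  have hg : ∑ s : Fin (n - 1), Y 0 (s + 1) * A⁻¹ s z = detYgamma n Y / detYbar n Y := by
    have h1 := Matrix.cramer_transpose_apply A (fun s => Y 0 (s + 1)) z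
    rw [Matrix.cramer_eq_adjugate_mulVec, ← Matrix.adjugate_transpose] at h1
    have h2 : (A.updateRow z fun s => Y 0 (s + 1)).det = detYgamma n Y := by
      unfold detYgamma
      congr 1
      ext i j
      rw [Matrix.updateRow_apply]
      by_cases h : (i : ℕ) = 0
      · simp [hz, Fin.ext_iff, h]
      · simp [hz, hA, Fin.ext_iff, h]
    rw [h2] at h1
    rw [eq_div_iff hYbar, ← h1, Finset.sum_mul]
    simp only [Matrix.mulVec, dotProduct, Matrix.transpose_apply]
    refine Finset.sum_congr rfl fun s _ => ?_
    rw [Matrix.inv_def, hdet, Matrix.smul_apply, smul_eq_mul, Ring.inverse_eq_inv']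
    field_simp
  ext i
  simp only [Matrix.mulVec, dotProduct, toSq, Matrix.of_apply]
  rw [sum_cons_zero n (by omega) (fun s => Y i s) (fun s => A⁻¹ s z)]
  unfold gammaVec
  by_cases hi : (i : ℕ) = 0
  · rw [hi, hg]
    simp
  · have h := hc ⟨i - 1, by omega⟩
    simp only [Nat.sub_add_cancel (show 1 ≤ (i : ℕ) by omega)] at h
    rw [h]
    by_cases h1 : (i : ℕ) = 1
    · simp [h1]
    · simp [h1, hi, show (i : ℕ) - 1 ≠ 0 by omega]

theorem sminor_stairCore_eq {n k b : ℕ} (X Y : ℕ → ℕ → ℂ)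
    (hX : ∀ i j, n ≤ i → X i j = 0) (hn : 2 ≤ n) (hk : 2 ≤ k)
    (hYinv : IsUnit (toSq n Y).det) (hYbar : detYbar n Y ≠ 0) (V : ℕ → Fin n → ℂ)
    (hV : V 0 = (toSq n X * (toSq n Y)⁻¹) *ᵥ gammaVec n Y) :
    sminor (stairCore n k X Y) 2 ((k - 1) * n + b)
      = (-1) ^ n * detYbar n Y
        * natDet ((k - 2) * n + b + 1) (reducedCore n k X Y V 1) := by
  obtain ⟨m, rfl⟩ := Nat.exists_eq_add_of_le' hk
  rw [show m + 2 - 1 = m + 1 from rfl, show m + 2 - 2 = m from rfl]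
  have hmn : (m + 1) * n = m * n + n := by ring
  obtain ⟨c, hc, hYc⟩ := exists_preimage_gammaVec n hn Y hYbar
  have hs : sminor (stairCore n (m + 2) X Y) 2 ((m + 1) * n + b)
      = natDet ((m + 1) * n + b - 1) (fun i j => stairCore n (m + 2) X Y (1 + i) (1 + j)) := rfl
  set f' : ℕ → ℕ → ℂ := fun i j =>
    if j = 0 then (if i = 0 then 1 else 0) else stairCore n (m + 2) X Y i j with hf'
  rw [hs, natDet_border _ 0 (by omega) _ f']
  · rw [show (m + 1) * n + b - 1 + 1 = (n - 1) + (m * n + b + 1) by omega,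
      natDet_eliminate (n - 1) 1 (m * n + b + 1) (by omega) f'
        (reducedCore n (m + 2) X Y V 1)
        (Matrix.of fun i j => Y ((i : ℕ) + 1) ((j : ℕ) + 1))
        (isUnit_iff_ne_zero.2 hYbar) ?_ ?_ ?_ (fun _ => c) ?_ ?_ ?_]
    · rw [pow_zero, one_mul, mul_one, Nat.sub_add_cancel (by omega)]
      rfl
    · intro i j
      have h := stairCore_diag (k := m + 2) (q := 0) (n := n) (j := 1 + j) X Y (by omega) i.isLt
        (by omega)
      simp only [hf', Matrix.of_apply]
      rw [if_neg (by omega), add_comm (j : ℕ) 1, ← h, zero_mul, zero_mul, add_zero, add_zero]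
    · intro i j hi hj hj2
      have h := stairCore_right (k := m + 2) (q := 0) (n := n) (j := j) X Y (by omega) hi
        (by omega)
      simp only [hf']
      rw [if_neg (by omega), ← h, zero_mul, zero_mul, add_zero, add_zero]
    · intro i j hi hj
      simp only [hf']
      rw [if_pos (by omega), if_neg (by omega)]
    · intro j hj i
      simp only [hf', if_pos (show j = 0 by omega)]
      exact hc i
    · intro i j hi hj
      obtain rfl : j = 0 := by omega
      have hf2 : ∀ s : Fin (n - 1), f' (n - 1 + i) (1 + s)
          = if i < n - 1 then X (i + 1) (s + 1) else 0 := by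
        intro s
        have h := stairCore_below (k := m + 2) (q := 0) (i := i) (j := s + 1) X Y hX hn (by omega)
          (by omega)
        simp only [hf']
        rw [if_neg (by omega), ← h, zero_mul, zero_add, one_mul, add_zero, add_comm i,
          add_comm 1 (s : ℕ)]
      simp only [hf2, reducedCore]
      rw [if_pos hj]
      by_cases hi2 : i + 1 < n
      · rw [dif_pos hi2, hV, ← hYc, Matrix.mulVec_mulVec, Matrix.mul_assoc,
          Matrix.nonsing_inv_mul _ hYinv, Matrix.mul_one]
        simp only [if_pos (show i < n - 1 by omega)]
        exact sum_cons_zero n (by omega) (fun s => X (i + 1) s) c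
      · rw [dif_neg hi2]
        simp only [if_neg (show ¬ i < n - 1 by omega), zero_mul, Finset.sum_const_zero]
    · intro i j hi hj hj2
      simp only [hf', reducedCore]
      rw [if_neg (by omega), if_neg (by omega)]
      congr 1 <;> omega
  · simp [hf']
  · intro i _
    simp [hf']
  · intro i j hi hj
    omega
  · intro i j hi hj hj2
    simp only [hf']
    rw [if_neg (by omega), add_comm i, add_comm j]

/-- The columns produced by eliminating `q` block rows:
`W^q (e_2 + γ e_1), W^{q-1} e_1, …, W e_1`, followed (at index `q`) by `e_1`. -/
def krylovCols (n : ℕ) (hn : 2 ≤ n) (X Y : ℕ → ℕ → ℂ) (q j : ℕ) : Fin n → ℂ :=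
  if j = 0 then ((toSq n X * (toSq n Y)⁻¹) ^ q) *ᵥ gammaVec n Y
  else ((toSq n X * (toSq n Y)⁻¹) ^ (q - j)) *ᵥ Pi.single ⟨0, by omega⟩ 1

theorem sminor_eq_reducedCore {n k b : ℕ} (X Y : ℕ → ℕ → ℂ)
    (hX : ∀ i j, n ≤ i → X i j = 0) (hn : 2 ≤ n)
    (hYinv : IsUnit (toSq n Y).det) (hYbar : detYbar n Y ≠ 0) (q m : ℕ) (hkm : k = q + m + 2) :
    sminor (stairCore n k X Y) 2 ((k - 1) * n + b)
      = (-1) ^ q * (-1) ^ (n * ((q + 2) * (q + 1) / 2)) * (toSq n Y).det ^ q * detYbar n Y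
        * natDet (m * n + b + (q + 1)) (reducedCore n k X Y (krylovCols n hn X Y (q + 1)) (q + 1))
        := by
  induction q generalizing m with
  | zero =>
    rw [sminor_stairCore_eq X Y hX hn (by omega) hYinv hYbar (krylovCols n hn X Y 1)
      (by simp [krylovCols])]
    simp [hkm]
  | succ q ih =>
    rw [ih (m + 1) (by omega), ← add_assoc ((m + 1) * n + b) q 1, add_assoc ((m + 1) * n + b) q 1,
      natDet_reducedCore_step X Y hX hn (show k = q + 1 + m + 2 by omega) hYinv _
      (krylovCols n hn X Y (q + 1 + 1)) ?_ ?_]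
    · have htri : (q + 1 + 2) * (q + 1 + 1) / 2 = (q + 2) * (q + 1) / 2 + (q + 2) := by
        rw [show (q + 1 + 2) * (q + 1 + 1) = (q + 2) * (q + 1) + (q + 2) * 2 by ring,
          Nat.add_mul_div_right _ _ (by norm_num)]
      rw [htri, mul_add n, pow_add (-1 : ℂ) (n * _), add_mul n 1 (q + 1 + 1),
        pow_add (-1 : ℂ) (n * (q + 1 + 1)), one_mul,
        show n * (q + 2) = n * (q + 1 + 1) from rfl, pow_succ (-1 : ℂ) (q + 1)]
      have hsq : (-1 : ℂ) ^ q * (-1) ^ q = 1 := by rw [← mul_pow]; simp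
      rw [pow_succ (-1 : ℂ) q, pow_succ (toSq n Y).det q, ← add_assoc (m * n + b) (q + 1) 1]
      linear_combination -(-1 : ℂ) ^ q * (-1) ^ (n * ((q + 2) * (q + 1) / 2))
        * (toSq n Y).det ^ q * (toSq n Y).det * detYbar n Y * (-1) ^ (n * (q + 1 + 1))
        * natDet (m * n + b + (q + 1) + 1)
          (reducedCore n k X Y (krylovCols n hn X Y (q + 1 + 1)) (q + 1 + 1)) * hsq
    · intro j hj
      unfold krylovCols
      by_cases h0 : j = 0
      · rw [if_pos h0, if_pos h0, Matrix.mulVec_mulVec, ← pow_succ']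
      · rw [if_neg h0, if_neg h0, Matrix.mulVec_mulVec, ← pow_succ',
          show q + 1 + 1 - j = q + 1 - j + 1 by omega]
    · unfold krylovCols
      rw [if_neg (by omega), show q + 1 + 1 - (q + 1) = 1 by omega, pow_one]

/-- The quotient map `ℂ^n → ℂ^k`, `x ↦ x_{[1,k]} - Y1 Y2⁻¹ x_{[k+1,k+b]}`. -/
def blockProj (n k b : ℕ) (h : k + b ≤ n) (Y : Matrix (Fin n) (Fin n) ℂ) (x : Fin n → ℂ) :
    Fin k → ℂ :=
  (fun i => x (Fin.castLE (by omega) i))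
    - ((Matrix.of fun (i : Fin k) (j : Fin b) =>
          Y (Fin.castLE (by omega) i) (Fin.castLE (by omega) j)) * (blockY2 n k b h Y)⁻¹) *ᵥ
      (fun i : Fin b => x ⟨k + (i : ℕ), by have := i.isLt; omega⟩)

theorem sum_extend_zero (n p : ℕ) (hp : p ≤ n) (y : Fin n → ℂ) (u : Fin p → ℂ) :
    ∑ s : Fin n, y s * (if h : (s : ℕ) < p then u ⟨s, h⟩ else 0)
      = ∑ s : Fin p, y (Fin.castLE hp s) * u s := by
  obtain ⟨m, rfl⟩ := Nat.exists_eq_add_of_le hp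
  rw [Fin.sum_univ_add]
  have h2 : ∑ i : Fin m, y (Fin.natAdd p i)
      * (if h : ((Fin.natAdd p i : Fin (p + m)) : ℕ) < p then u ⟨_, h⟩ else 0) = 0 := by
    simp
  rw [h2, add_zero]
  refine Finset.sum_congr rfl fun i _ => ?_
  simp only [Fin.val_castAdd, i.isLt, dif_pos]
  rfl

theorem blockProj_mulVec {n k b : ℕ} (hn : k + b ≤ n) (X Y : Matrix (Fin n) (Fin n) ℂ)
    (hX : ∀ i j : Fin n, (j : ℕ) < b → X i j = 0)
    (hY : ∀ i j : Fin n, k + b ≤ (i : ℕ) → (j : ℕ) < b → Y i j = 0)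
    (hYinv : IsUnit Y.det) (hY2inv : IsUnit (blockY2 n k b hn Y).det)
    (x : Fin n → ℂ) (hx : ∀ i : Fin n, k + b ≤ (i : ℕ) → x i = 0) :
    blockProj n k b hn Y ((X * Y⁻¹) *ᵥ x) = blockU n k b hn X Y *ᵥ blockProj n k b hn Y x := by
  set x2 : Fin b → ℂ := fun i => x ⟨k + (i : ℕ), by have := i.isLt; omega⟩ with hx2
  set y : Fin b → ℂ := (blockY2 n k b hn Y)⁻¹ *ᵥ x2 with hy
  set z : Fin n → ℂ := fun s => if h : (s : ℕ) < b then y ⟨s, h⟩ else 0 with hz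
  set t := blockProj n k b hn Y x with ht
  set w : Fin n → ℂ := fun s => if h : (s : ℕ) < k then t ⟨s, h⟩ else 0 with hw
  have hsplit : x = Y *ᵥ z + w := by
    ext i
    have hYz : (Y *ᵥ z) i = ∑ s : Fin b, Y i (Fin.castLE (by omega) s) * y s :=
      sum_extend_zero n b (by omega) (fun s => Y i s) y
    rw [Pi.add_apply, hYz]
    by_cases hik : (i : ℕ) < k
    · have : w i = t ⟨i, hik⟩ := dif_pos hik
      rw [this, ht]
      unfold blockProj
      rw [← Matrix.mulVec_mulVec, ← hx2, ← hy]
      simp [Matrix.mulVec, dotProduct, Fin.castLE]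
    · have : w i = 0 := dif_neg hik
      rw [this, add_zero]
      by_cases hia : (i : ℕ) < k + b
      · have h1 : (blockY2 n k b hn Y *ᵥ y) ⟨i - k, by omega⟩ = x2 ⟨i - k, by omega⟩ := by
          rw [hy, Matrix.mulVec_mulVec, Matrix.mul_nonsing_inv _ hY2inv, Matrix.one_mulVec]
        have h2 : x2 ⟨i - k, by omega⟩ = x i := by
          simp only [hx2]
          congr 1
          ext
          simp only
          omega
        rw [← h2, ← h1]
        simp only [Matrix.mulVec, dotProduct, blockY2, Matrix.of_apply,
          Nat.add_sub_cancel' (show k ≤ (i : ℕ) by omega)]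
      · rw [hx i (by omega), Finset.sum_eq_zero]
        intro s _
        rw [hY i _ (by omega) (by simp), zero_mul]
  have hXz : X *ᵥ z = 0 := by
    ext i
    refine (sum_extend_zero n b (by omega) (fun s => X i s) y).trans ?_
    exact Finset.sum_eq_zero fun s _ => by rw [hX i _ (by simp), zero_mul]
  have hWx : (X * Y⁻¹) *ᵥ x = (X * Y⁻¹) *ᵥ w := by
    rw [hsplit, Matrix.mulVec_add, Matrix.mulVec_mulVec, Matrix.mul_assoc,
      Matrix.nonsing_inv_mul _ hYinv, Matrix.mul_one, hXz, zero_add]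
  have hWw : ∀ i : Fin n, ((X * Y⁻¹) *ᵥ w) i
      = ∑ s : Fin k, (X * Y⁻¹) i (Fin.castLE (by omega) s) * t s := fun i =>
    sum_extend_zero n k (by omega) (fun s => (X * Y⁻¹) i s) t
  rw [hWx]
  unfold blockU
  generalize X * Y⁻¹ = W at hWw ⊢
  rw [Matrix.sub_mulVec, ← Matrix.mulVec_mulVec]
  unfold blockProj
  congr 1
  · funext i
    exact hWw _
  · congr 1
    funext i
    exact hWw _

theorem blockProj_pow_mulVec {n k b : ℕ} (hn : k + b ≤ n) (X Y : Matrix (Fin n) (Fin n) ℂ)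
    (hX : ∀ i j : Fin n, (k + b ≤ (i : ℕ) ∨ (j : ℕ) < b) → X i j = 0)
    (hY : ∀ i j : Fin n, k + b ≤ (i : ℕ) → (j : ℕ) < b → Y i j = 0)
    (hYinv : IsUnit Y.det) (hY2inv : IsUnit (blockY2 n k b hn Y).det)
    (x : Fin n → ℂ) (hx : ∀ i : Fin n, k + b ≤ (i : ℕ) → x i = 0) (p : ℕ) :
    blockProj n k b hn Y (((X * Y⁻¹) ^ p) *ᵥ x)
      = (blockU n k b hn X Y ^ p) *ᵥ blockProj n k b hn Y x := by
  induction p generalizing x with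
  | zero => simp
  | succ p ih =>
    rw [pow_succ, pow_succ, ← Matrix.mulVec_mulVec, ih, blockProj_mulVec hn X Y
      (fun i j h => hX i j (Or.inr h)) hY hYinv hY2inv x hx, Matrix.mulVec_mulVec]
    intro i hi
    rw [← Matrix.mulVec_mulVec]
    simp only [Matrix.mulVec, dotProduct, hX i _ (Or.inl hi), zero_mul, Finset.sum_const_zero]

theorem blockProj_of_support {n k b : ℕ} (hn : k + b ≤ n) (Y : Matrix (Fin n) (Fin n) ℂ)
    (x : Fin n → ℂ) (hx : ∀ i : Fin n, k ≤ (i : ℕ) → x i = 0) :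
    blockProj n k b hn Y x = fun i => x (Fin.castLE (by omega) i) := by
  unfold blockProj
  have h0 : (fun i : Fin b => x ⟨k + (i : ℕ), by have := i.isLt; omega⟩) = 0 := by
    funext i
    exact hx _ (by simp)
  rw [h0, Matrix.mulVec_zero, sub_zero]

/-- Schur complement of the block `Y2`: the columns `V` get replaced by their projections. -/
theorem natDet_blockProj {n k b : ℕ} (hn : k + b ≤ n) (Y : ℕ → ℕ → ℂ)
    (hY2inv : IsUnit (blockY2 n k b hn (toSq n Y)).det) (V : ℕ → Fin n → ℂ) :
    natDet (k + b) (fun i j => if j < k then (if h : i < n then V j ⟨i, h⟩ else 0)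
        else Y i (j - k))
      = (blockY2 n k b hn (toSq n Y)).det
        * (Matrix.of fun i j : Fin k => blockProj n k b hn (toSq n Y) (V j) i).det := by
  have hinv : Invertible (blockY2 n k b hn (toSq n Y)) := Matrix.invertibleOfIsUnitDet _ hY2inv
  rw [natDet_fromBlocks]
  have h22 : (Matrix.of fun i j : Fin b => if k + (j : ℕ) < k then
      (if h : k + (i : ℕ) < n then V (k + j) ⟨k + i, h⟩ else 0) else Y (k + i) (k + j - k))
      = blockY2 n k b hn (toSq n Y) := by
    ext i j
    simp [blockY2, toSq]
  rw [h22, Matrix.det_fromBlocks₂₂, Matrix.invOf_eq_nonsing_inv]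
  congr 2
  ext i j
  unfold blockProj
  rw [Matrix.sub_apply, Matrix.of_apply, Matrix.of_apply, Pi.sub_apply, if_pos j.isLt,
    dif_pos (by omega)]
  congr 1
  rw [Matrix.mul_apply]
  refine Finset.sum_congr rfl fun s _ => ?_
  congr 1
  · refine Matrix.mul_apply.trans (Eq.trans ?_ Matrix.mul_apply.symm)
    refine Finset.sum_congr rfl fun t _ => ?_
    simp [toSq]
  · rw [Matrix.of_apply, if_pos j.isLt, dif_pos (by omega)]

theorem natDet_reducedCore_last {n k b : ℕ} (hn2 : 2 ≤ n) (hk : 2 ≤ k) (hn : k + b ≤ n)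
    (X Y : ℕ → ℕ → ℂ) :
    natDet (b + (k - 1)) (reducedCore n k X Y (krylovCols n hn2 X Y (k - 1)) (k - 1))
      = (-1) ^ (k - 1) * natDet (k + b) (fun i j => if j < k then
          (if h : i < n then krylovCols n hn2 X Y (k - 1) j ⟨i, h⟩ else 0) else Y i (j - k)) := by
  have hlast : krylovCols n hn2 X Y (k - 1) (k - 1) = Pi.single ⟨0, by omega⟩ 1 := by
    unfold krylovCols
    rw [if_neg (by omega), Nat.sub_self, pow_zero, Matrix.one_mulVec]
  rw [show k + b = b + (k - 1) + 1 by omega]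
  refine natDet_border _ (k - 1) (by omega) _ _ ?_ ?_ ?_ ?_
  · rw [if_pos (by omega), dif_pos (by omega), hlast, Pi.single_eq_same]
  · intro i hi
    rw [if_pos (by omega), dif_pos (by omega), hlast, Pi.single_eq_of_ne]
    simp [Fin.ext_iff]
  · intro i j hi hj
    simp only [reducedCore]
    rw [if_pos (by omega), if_pos hj]
  · intro i j hi hj hj2
    simp only [reducedCore]
    rw [if_neg (by omega), if_neg (by omega), stairCore_last]
    congr 1
    omega

/-- the minor `φ_2` via `U`:
`φ_2 = ε_2 (det Y)^(k-2) det Ȳ det Y2 · det[U^{k-2}v_γ, U^{k-2}e_1, …, U e_1, e_1]`. -/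
theorem statement7 (n k b : ℕ) (hk : 2 ≤ k) (hn : k + b ≤ n)
    (X Y : ℕ → ℕ → ℂ)
    (hX : ∀ i j : ℕ, (k + b ≤ i ∨ j < b) → X i j = 0)
    (hY : ∀ i j : ℕ, k + b ≤ i → j < b → Y i j = 0)
    (hYinv : IsUnit (toSq n Y).det)
    (hY2inv : IsUnit (blockY2 n k b hn (toSq n Y)).det)
    (hYbar : detYbar n Y ≠ 0) :
    sminor (stairCore n k X Y) 2 ((k - 1) * n + b)
      = -(-1 : ℂ) ^ (n * (k * (k - 1) / 2)) * (toSq n Y).det ^ (k - 2)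
        * detYbar n Y * (blockY2 n k b hn (toSq n Y)).det
        * (Matrix.of fun i j : Fin k =>
            if (j : ℕ) = 0 then
              ((blockU n k b hn (toSq n X) (toSq n Y)) ^ (k - 2)).mulVec
                (vGamma n k b hn X Y) i
            else
              ((blockU n k b hn (toSq n X) (toSq n Y)) ^ (k - 1 - (j : ℕ))).mulVec
                (basisVec k 0) i).det := by
  have hn2 : 2 ≤ n := by omega
  have hXn : ∀ i j, n ≤ i → X i j = 0 := fun i j hi => hX i j (Or.inl (by omega))
  have h1 := sminor_eq_reducedCore (k := k) (b := b) X Y hXn hn2 hYinv hYbar (k - 2) 0 (by omega)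
  rw [show k - 2 + 1 = k - 1 by omega, show k - 2 + 2 = k by omega, zero_mul, zero_add,
    natDet_reducedCore_last hn2 hk hn X Y, natDet_blockProj hn Y hY2inv] at h1
  have hpow := blockProj_pow_mulVec hn (toSq n X) (toSq n Y) (fun i j h => hX i j h)
    (fun i j hi hj => hY i j hi hj) hYinv hY2inv
  have hg : blockProj n k b hn (toSq n Y) (gammaVec n Y)
      = basisVec k 1 + (detYgamma n Y / detYbar n Y) • basisVec k 0 := by
    rw [blockProj_of_support hn _ _ fun i hi => by
      simp [gammaVec, show (i : ℕ) ≠ 0 by omega, show (i : ℕ) ≠ 1 by omega]]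
    funext i
    simp [gammaVec, basisVec]
  have he : blockProj n k b hn (toSq n Y) (Pi.single ⟨0, by omega⟩ 1) = basisVec k 0 := by
    rw [blockProj_of_support hn _ _ fun i hi => by
      rw [Pi.single_eq_of_ne]
      simp only [ne_eq, Fin.ext_iff]
      omega]
    funext i
    simp [basisVec, Pi.single_apply, Fin.ext_iff]
  have hcols : (Matrix.of fun i j : Fin k =>
      blockProj n k b hn (toSq n Y) (krylovCols n hn2 X Y (k - 1) j) i)
      = Matrix.of fun i j : Fin k =>
            if (j : ℕ) = 0 then
              ((blockU n k b hn (toSq n X) (toSq n Y)) ^ (k - 2)).mulVec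
                (vGamma n k b hn X Y) i
            else
              ((blockU n k b hn (toSq n X) (toSq n Y)) ^ (k - 1 - (j : ℕ))).mulVec
                (basisVec k 0) i := by
    ext i j
    simp only [Matrix.of_apply, krylovCols]
    split_ifs with hj
    · rw [hpow _ (fun i hi => by
        simp [gammaVec, show (i : ℕ) ≠ 0 by omega, show (i : ℕ) ≠ 1 by omega]), hg]
      unfold vGamma
      rw [Matrix.mulVec_mulVec, ← pow_succ, show k - 2 + 1 = k - 1 by omega]
    · rw [hpow _ (fun i hi => by
        rw [Pi.single_eq_of_ne]
        simp only [ne_eq, Fin.ext_iff]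
        omega), he]
  rw [hcols] at h1
  rw [h1, show k - 1 = k - 2 + 1 by omega, pow_succ (-1 : ℂ) (k - 2)]
  have hsq : (-1 : ℂ) ^ (k - 2) * (-1) ^ (k - 2) = 1 := by rw [← mul_pow]; simp
  set s := (-1 : ℂ) ^ (k - 2)
  generalize (-1 : ℂ) ^ (n * (k * (k - 2 + 1) / 2)) = N
  generalize Matrix.det (Matrix.of _ : Matrix (Fin k) (Fin k) ℂ) = D
  linear_combination -N * (toSq n Y).det ^ (k - 2) * detYbar n Y
    * (blockY2 n k b hn (toSq n Y)).det * D * hsq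

end
end
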